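/- There exist constants γ ∈ (0,1] and N, depending only on δ, K, and d, such that if L ∈ 𝔏_{δ,K} has coefficients independent of t, u ∈ W²_{d,loc}(B₁) ∩ C(B̄₁), and Lu = g − f in B₁ with f ≥ 0, then ∫_{B₁} |f|^γ dx ≤ N (∫_{B₁} |g₊|^d dx)^{γ/d} + N |u₊(0)|^γ + N sup_{∂B₁} |u₋|^γ, where g₊, u₊, u₋ denote positive and negative parts. -/

import Mathlib

open MeasureTheory ENNReal Set

noncomputable section

/-- The Frobenius norm of a matrix, used as `|D²u|`. -/
def frobNorm {d : ℕ} (m : Matrix (Fin d) (Fin d) ℝ) : ℝ :=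
  Real.sqrt (∑ i, ∑ j, (m i j) ^ 2)

open scoped Topology

section Part1

abbrev Eu (d : ℕ) := EuclideanSpace ℝ (Fin d)

abbrev eb {d : ℕ} (i : Fin d) : Eu d := EuclideanSpace.single i (1 : ℝ)

/-- the matrix of a continuous linear map -/
def matOf {d : ℕ} (T : Eu d →L[ℝ] Eu d) : Matrix (Fin d) (Fin d) ℝ :=
  Matrix.of fun i j => (T (eb j)) i

/-- `tr (a T)` -/
def trA {d : ℕ} (a : Matrix (Fin d) (Fin d) ℝ) (T : Eu d →L[ℝ] Eu d) : ℝ :=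
  ∑ i, ∑ j, a i j * (T (eb j)) i

/-- ellipticity -/
def Ell {d : ℕ} (δ : ℝ) (a : Matrix (Fin d) (Fin d) ℝ) : Prop :=
  ∀ ξ : Eu d, δ * ‖ξ‖ ^ 2 ≤ ∑ i, ∑ j, a i j * ξ i * ξ j ∧
          ∑ i, ∑ j, a i j * ξ i * ξ j ≤ δ⁻¹ * ‖ξ‖ ^ 2

lemma trA_add {d : ℕ} (a : Matrix (Fin d) (Fin d) ℝ) (S T : Eu d →L[ℝ] Eu d) :
    trA a (S + T) = trA a S + trA a T := by
  simp [trA, mul_add, Finset.sum_add_distrib]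

lemma trA_smul {d : ℕ} (a : Matrix (Fin d) (Fin d) ℝ) (c : ℝ) (T : Eu d →L[ℝ] Eu d) :
    trA a (c • T) = c * trA a T := by
  simp only [trA, Finset.mul_sum]
  refine Finset.sum_congr rfl fun i _ => Finset.sum_congr rfl fun j _ => ?_
  simp; ring

lemma trA_id_le {d : ℕ} {δ : ℝ} {a : Matrix (Fin d) (Fin d) ℝ} (h : Ell δ a) :
    trA a (ContinuousLinearMap.id ℝ (Eu d)) ≤ d / δ := by
  have h1 : ∀ i, a i i ≤ δ⁻¹ := by
    intro i
    have := (h (eb i)).2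
    simp at this
    simpa using this
  have h2 : trA a (ContinuousLinearMap.id ℝ (Eu d)) = ∑ i, a i i := by
    simp [trA]
  rw [h2]
  calc _ ≤ ∑ i : Fin d, δ⁻¹ := Finset.sum_le_sum fun i _ => h1 i
    _ = d / δ := by simp [div_eq_mul_inv]

lemma det_eq_matOf {d : ℕ} (T : Eu d →L[ℝ] Eu d) : T.det = (matOf T).det := by
  have h := LinearMap.det_toMatrix (EuclideanSpace.basisFun (Fin d) ℝ).toBasis (T : Eu d →ₗ[ℝ] Eu d)
  rw [ContinuousLinearMap.det, ← h]
  congr 1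

lemma trA_ge_trace {d : ℕ} {δ : ℝ} {a S : Matrix (Fin d) (Fin d) ℝ} (h : Ell δ a)
    (hS : S.PosSemidef) : δ * S.trace ≤ ∑ i, ∑ j, a i j * S i j := by
  obtain ⟨m, v, hv⟩ := Matrix.posSemidef_iff_eq_sum_vecMulVec.1 hS
  have e1 : ∀ i j, S i j = ∑ k, v k i * v k j := by
    intro i j
    rw [hv]
    simp [Matrix.sum_apply, Matrix.vecMulVec_apply]
  have e2 : δ * S.trace = ∑ k, δ * ‖(WithLp.toLp 2 (v k) : Eu d)‖ ^ 2 := by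
    simp only [Matrix.trace, Matrix.diag, e1, EuclideanSpace.norm_sq_eq, Real.norm_eq_abs, sq_abs]
    rw [Finset.sum_comm, Finset.mul_sum]
    refine Finset.sum_congr rfl fun k _ => ?_
    congr 1
    exact Finset.sum_congr rfl fun i _ => by ring
  have e3 : ∑ i, ∑ j, a i j * S i j = ∑ k, ∑ i, ∑ j, a i j * v k i * v k j := by
    rw [Finset.sum_comm (s := (Finset.univ : Finset (Fin m)))]
    refine Finset.sum_congr rfl fun i _ => ?_
    rw [Finset.sum_comm]
    refine Finset.sum_congr rfl fun j _ => ?_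
    rw [e1, Finset.mul_sum]
    exact Finset.sum_congr rfl fun k _ => by ring
  rw [e2, e3]
  exact Finset.sum_le_sum fun k _ => (h (WithLp.toLp 2 (v k))).1

lemma det_le_trace_pow {d : ℕ} {S : Matrix (Fin d) (Fin d) ℝ}
    (hS : S.PosSemidef) : S.det ≤ S.trace ^ d := by
  rw [hS.isHermitian.det_eq_prod_eigenvalues, hS.isHermitian.trace_eq_sum_eigenvalues]
  simp only [RCLike.ofReal_real_eq_id, id]
  have : ∀ i, hS.isHermitian.eigenvalues i ≤ ∑ j, hS.isHermitian.eigenvalues j := fun i =>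
    Finset.single_le_sum (f := fun j => hS.isHermitian.eigenvalues j) (fun j _ => hS.eigenvalues_nonneg j) (Finset.mem_univ i)
  calc _ ≤ ∏ i : Fin d, ∑ j, hS.isHermitian.eigenvalues j :=
        Finset.prod_le_prod (fun i _ => hS.eigenvalues_nonneg i) fun i _ => this i
    _ = _ := by simp

/-- Linear algebra core: a symmetric nonnegative `T` has `0 ≤ tr(aT)` and `|det T| ≤ (tr(aT)/δ)^d`. -/
lemma linalg_core {d : ℕ} {δ : ℝ} (hδ : 0 < δ) {a : Matrix (Fin d) (Fin d) ℝ} (h : Ell δ a)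
    (T : Eu d →L[ℝ] Eu d) (hsym : ∀ x y, inner ℝ (T x) y = inner ℝ (T y) x)
    (hpos : ∀ x, 0 ≤ inner ℝ (T x) x) :
    0 ≤ trA a T ∧ |T.det| ≤ (trA a T / δ) ^ d := by
  have hm : (matOf T).PosSemidef := by
    refine Matrix.PosSemidef.of_dotProduct_mulVec_nonneg ?_ ?_
    · ext i j
      have := hsym (eb i) (eb j)
      simpa [matOf, EuclideanSpace.inner_single_right] using this
    · intro x
      have h0 := hpos (WithLp.toLp 2 x)
      have hx : (WithLp.toLp 2 x : Eu d) = ∑ j, x j • eb j := by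
        ext i; simp [Pi.single_apply]
      have : inner ℝ (T (WithLp.toLp 2 x)) (WithLp.toLp 2 x : Eu d) = star x ⬝ᵥ ((matOf T).mulVec x) := by
        rw [PiLp.inner_apply]
        simp only [dotProduct, Matrix.mulVec]
        refine Finset.sum_congr rfl fun i _ => ?_
        rw [hx, map_sum]
        simp [matOf, mul_comm]
      rwa [this] at h0
  have h1 : δ * (matOf T).trace ≤ trA a T := trA_ge_trace h hm
  have h2 := hm.trace_nonneg
  refine ⟨le_trans (by positivity) h1, ?_⟩
  rw [det_eq_matOf, abs_of_nonneg hm.det_nonneg]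
  refine (det_le_trace_pow hm).trans (pow_le_pow_left₀ h2 ?_ d)
  rw [le_div_iff₀ hδ]; linarith

end Part1

section Part2

lemma sec_order {d : ℕ} {v : Eu d → ℝ} {G : Eu d → Eu d} {T : Eu d →L[ℝ] Eu d} {x : Eu d}
    (hG : ∀ᶠ y in 𝓝 x, HasFDerivAt v (innerSL ℝ (G y)) y) (hT : HasFDerivAt G T x)
    (hmin : IsLocalMin v x) :
    G x = 0 ∧ (∀ ξ, 0 ≤ inner ℝ (T ξ) ξ) ∧ (∀ ξ η, inner ℝ (T ξ) η = inner ℝ (T η) ξ) := by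
  have h0 : G x = 0 := by
    have := hmin.hasFDerivAt_eq_zero hG.self_of_nhds
    have h2 : innerSL ℝ (G x) (G x) = 0 := by rw [this]; simp
    simpa using h2
  refine ⟨h0, ?_, ?_⟩
  · intro ξ
    by_contra hneg
    push Not at hneg
    set q := inner ℝ (T ξ) ξ with hq
    have hline : Filter.Tendsto (fun t : ℝ => x + t • ξ) (𝓝 0) (𝓝 x) := by
      have : Continuous (fun t : ℝ => x + t • ξ) := by fun_prop
      have := this.tendsto 0
      simpa using this
    have hl : ∀ t : ℝ, HasDerivAt (fun t : ℝ => x + t • ξ) ξ t := by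
      intro t
      have := ((hasDerivAt_id t).smul_const ξ).const_add x
      simpa using this
    -- ψ t = -(v (x + tξ)) + (q/4) t^2
    set ψ : ℝ → ℝ := fun t => -(v (x + t • ξ)) + (q / 4) * t ^ 2 with hψ
    have hd1 : ∀ᶠ t in 𝓝 (0 : ℝ), HasDerivAt ψ (-(inner ℝ (G (x + t • ξ)) ξ) + (q / 2) * t) t := by
      filter_upwards [hline.eventually hG] with t ht
      have h1 := ht.comp_hasDerivAt t (hl t)
      have h2 := (h1.neg).add (((hasDerivAt_id t).pow 2).const_mul (q / 4))
      refine h2.congr_deriv ?_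
      simp; ring
    have hd1' : deriv ψ =ᶠ[𝓝 0] fun t => -(inner ℝ (G (x + t • ξ)) ξ) + (q / 2) * t := by
      filter_upwards [hd1] with t ht using ht.deriv
    have hd2 : HasDerivAt (fun t : ℝ => -(inner ℝ (G (x + t • ξ)) ξ) + (q / 2) * t) (-q + q / 2) 0 := by
      have h1 : HasDerivAt (fun t : ℝ => G (x + t • ξ)) (T ξ) 0 := by
        have hT' : HasFDerivAt G T (x + (0 : ℝ) • ξ) := by simpa using hT
        exact hT'.comp_hasDerivAt (0 : ℝ) (hl 0)
      have h2 := (h1.inner ℝ (hasDerivAt_const (0 : ℝ) ξ)).neg.add ((hasDerivAt_id (0 : ℝ)).const_mul (q / 2))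
      refine h2.congr_deriv ?_
      simp [hq]
    have hm : IsLocalMin ψ 0 := by
      apply isLocalMin_of_deriv_deriv_pos
      · rw [hd1'.deriv_eq, hd2.deriv]; linarith
      · rw [hd1'.self_of_nhds]; simp [h0]
      · exact hd1.self_of_nhds.continuousAt
    have hm2 : ∀ᶠ t in 𝓝 (0 : ℝ), v x ≤ v (x + t • ξ) := hline.eventually hmin
    have hm3 : ∀ᶠ t in 𝓝 (0 : ℝ), t = 0 := by
      filter_upwards [hm, hm2] with t h1 h2
      simp only [hψ] at h1
      simp at h1
      have : 0 ≤ (q / 4) * t ^ 2 := by linarith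
      have h3 : t ^ 2 ≤ 0 := by
        by_contra hc
        push Not at hc
        nlinarith
      have := le_antisymm h3 (sq_nonneg t)
      exact pow_eq_zero_iff (two_ne_zero) |>.1 this
    have h4 : ∀ᶠ t in 𝓝[≠] (0 : ℝ), t = 0 := hm3.filter_mono nhdsWithin_le_nhds
    have h5 : ∀ᶠ t in 𝓝[≠] (0 : ℝ), t ≠ 0 := eventually_mem_nhdsWithin
    obtain ⟨t, ht, ht'⟩ := (h4.and h5).exists
    exact ht' ht
  · intro ξ η
    have hf : HasFDerivAt (fun y => innerSL ℝ (G y)) ((innerSL ℝ).comp T) x :=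
      (innerSL ℝ : Eu d →L[ℝ] _).hasFDerivAt.comp x hT
    have := second_derivative_symmetric_of_eventually hG hf ξ η
    simpa using this

lemma hasFDerivAt_halfsq {d : ℕ} (κ : ℝ) (y x : Eu d) :
    HasFDerivAt (fun x : Eu d => κ / 2 * ‖x - y‖ ^ 2) (innerSL ℝ (κ • (x - y))) x := by
  have h1 : HasFDerivAt (fun x : Eu d => x - y) (ContinuousLinearMap.id ℝ (Eu d)) x :=
    (hasFDerivAt_id x).sub_const y
  have h2 := (h1.norm_sq).const_mul (κ / 2)
  refine h2.congr_fderiv ?_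
  ext z
  simp
  ring

lemma min_info {d : ℕ} {v : Eu d → ℝ} {G : Eu d → Eu d} {T : Eu d → Eu d →L[ℝ] Eu d} {R κ : ℝ}
    (hG : ∀ x ∈ Metric.ball (0 : Eu d) R, HasFDerivAt v (innerSL ℝ (G x)) x)
    (hT : ∀ x ∈ Metric.ball (0 : Eu d) R, HasFDerivAt G (T x) x) {x y : Eu d}
    (hx : x ∈ Metric.ball (0 : Eu d) R)
    (hmin : ∀ x' ∈ Metric.closedBall (0 : Eu d) R,
      v x + κ / 2 * ‖x - y‖ ^ 2 ≤ v x' + κ / 2 * ‖x' - y‖ ^ 2) :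
    G x + κ • (x - y) = 0 ∧
    (∀ ξ, 0 ≤ inner ℝ ((T x + κ • ContinuousLinearMap.id ℝ (Eu d)) ξ) ξ) ∧
    (∀ ξ η, inner ℝ ((T x + κ • ContinuousLinearMap.id ℝ (Eu d)) ξ) η
      = inner ℝ ((T x + κ • ContinuousLinearMap.id ℝ (Eu d)) η) ξ) := by
  have hnb : ∀ᶠ z in 𝓝 x, z ∈ Metric.ball (0 : Eu d) R := Metric.isOpen_ball.mem_nhds hx
  refine sec_order (v := fun x => v x + κ / 2 * ‖x - y‖ ^ 2) (G := fun x => G x + κ • (x - y)) (x := x) ?_ ?_ ?_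
  · filter_upwards [hnb] with z hz
    have := (hG z hz).add (hasFDerivAt_halfsq κ y z)
    rw [map_add]
    exact this
  · have h1 : HasFDerivAt (fun x : Eu d => κ • (x - y)) (κ • ContinuousLinearMap.id ℝ (Eu d)) x :=
      ((hasFDerivAt_id x).sub_const y).const_smul κ
    exact (hT x hx).add h1
  · filter_upwards [hnb] with z hz
    exact hmin z (Metric.ball_subset_closedBall hz)

/-- contact set -/
def contactSet {d : ℕ} (v : Eu d → ℝ) (R κ : ℝ) (V : Set (Eu d)) : Set (Eu d) :=
  {x | x ∈ Metric.closedBall (0 : Eu d) R ∧ ∃ y ∈ V, ∀ x' ∈ Metric.closedBall (0 : Eu d) R,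
      v x + κ / 2 * ‖x - y‖ ^ 2 ≤ v x' + κ / 2 * ‖x' - y‖ ^ 2}

lemma isClosed_contactSet {d : ℕ} {v : Eu d → ℝ} {R κ : ℝ} {V : Set (Eu d)}
    (hv : ContinuousOn v (Metric.closedBall (0 : Eu d) R)) (hV : IsCompact V) :
    IsClosed (contactSet v R κ V) := by
  set B := Metric.closedBall (0 : Eu d) R
  have hB : IsCompact B := isCompact_closedBall _ _
  have hK : IsCompact (B ×ˢ V) := hB.prod hV
  have hc : ∀ x' : Eu d, ContinuousOn (fun p : Eu d × Eu d =>
      v p.1 + κ / 2 * ‖p.1 - p.2‖ ^ 2 - (v x' + κ / 2 * ‖x' - p.2‖ ^ 2)) (B ×ˢ V) := by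
    intro x'
    have h1 : ContinuousOn (fun p : Eu d × Eu d => v p.1) (B ×ˢ V) :=
      hv.comp continuousOn_fst (fun p hp => hp.1)
    have h2 : Continuous (fun p : Eu d × Eu d => κ / 2 * ‖p.1 - p.2‖ ^ 2) := by fun_prop
    have h3 : Continuous (fun p : Eu d × Eu d => v x' + κ / 2 * ‖x' - p.2‖ ^ 2) := by fun_prop
    exact (h1.add h2.continuousOn).sub h3.continuousOn
  have hC : IsClosed {p : Eu d × Eu d | p ∈ B ×ˢ V ∧ ∀ x' ∈ B,
      v p.1 + κ / 2 * ‖p.1 - p.2‖ ^ 2 - (v x' + κ / 2 * ‖x' - p.2‖ ^ 2) ≤ 0} := by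
    have : {p : Eu d × Eu d | p ∈ B ×ˢ V ∧ ∀ x' ∈ B,
      v p.1 + κ / 2 * ‖p.1 - p.2‖ ^ 2 - (v x' + κ / 2 * ‖x' - p.2‖ ^ 2) ≤ 0}
      = (B ×ˢ V) ∩ ⋂ x' ∈ B, ((B ×ˢ V) ∩ (fun p : Eu d × Eu d =>
      v p.1 + κ / 2 * ‖p.1 - p.2‖ ^ 2 - (v x' + κ / 2 * ‖x' - p.2‖ ^ 2)) ⁻¹' Set.Iic 0) := by
      ext p
      simp only [mem_ofPred_eq, mem_inter_iff, mem_iInter, mem_preimage, mem_Iic]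
      constructor
      · rintro ⟨h1, h2⟩; exact ⟨h1, fun x' hx' => ⟨h1, h2 x' hx'⟩⟩
      · rintro ⟨h1, h2⟩; exact ⟨h1, fun x' hx' => (h2 x' hx').2⟩
    rw [this]
    refine hK.isClosed.inter (isClosed_biInter fun x' _ => ?_)
    exact (hc x').preimage_isClosed_of_isClosed hK.isClosed isClosed_Iic
  have himg : contactSet v R κ V = Prod.fst '' {p : Eu d × Eu d | p ∈ B ×ˢ V ∧ ∀ x' ∈ B,
      v p.1 + κ / 2 * ‖p.1 - p.2‖ ^ 2 - (v x' + κ / 2 * ‖x' - p.2‖ ^ 2) ≤ 0} := by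
    ext x
    constructor
    · rintro ⟨hx, y, hy, h⟩
      exact ⟨(x, y), ⟨⟨hx, hy⟩, fun x' hx' => sub_nonpos.2 (h x' hx')⟩, rfl⟩
    · rintro ⟨⟨x, y⟩, ⟨⟨hx, hy⟩, h⟩, rfl⟩
      exact ⟨hx, y, hy, fun x' hx' => sub_nonpos.1 (h x' hx')⟩
  rw [himg]
  exact ((hK.of_isClosed_subset hC (fun p hp => hp.1)).image continuous_fst).isClosed

/-- The contact (ABP) lemma. -/
lemma contact_lemma {d : ℕ} {δ : ℝ} (hδ : 0 < δ)
    {a : Eu d → Matrix (Fin d) (Fin d) ℝ} (ha : ∀ x, Ell δ (a x))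
    {v : Eu d → ℝ} {G : Eu d → Eu d} {T : Eu d → Eu d →L[ℝ] Eu d} {R κ : ℝ} (hR : 0 ≤ R) (hκ : 0 < κ)
    (hv : ContinuousOn v (Metric.closedBall (0 : Eu d) R))
    (hG : ∀ x ∈ Metric.ball (0 : Eu d) R, HasFDerivAt v (innerSL ℝ (G x)) x)
    (hT : ∀ x ∈ Metric.ball (0 : Eu d) R, HasFDerivAt G (T x) x)
    {V : Set (Eu d)} (hV : IsCompact V) (h : Eu d → ℝ)
    (hcon : ∀ y ∈ V, ∀ x ∈ Metric.closedBall (0 : Eu d) R,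
      (∀ x' ∈ Metric.closedBall (0 : Eu d) R,
      v x + κ / 2 * ‖x - y‖ ^ 2 ≤ v x' + κ / 2 * ‖x' - y‖ ^ 2) →
      x ∈ Metric.ball (0 : Eu d) R ∧
      (x ∈ Metric.ball (0 : Eu d) R → G x + κ • (x - y) = 0 →
        trA (a x) (T x + κ • ContinuousLinearMap.id ℝ (Eu d)) ≤ h x)) :
    volume V ≤ ∫⁻ x in contactSet v R κ V, ENNReal.ofReal ((h x / (δ * κ)) ^ d) := by
  set A := contactSet v R κ V
  set Y : Eu d → Eu d := fun x => x + κ⁻¹ • G x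
  have hA : MeasurableSet A := (isClosed_contactSet hv hV).measurableSet
  have hsub : V ⊆ Y '' A := by
    intro y hy
    have hc : ContinuousOn (fun x => v x + κ / 2 * ‖x - y‖ ^ 2) (Metric.closedBall (0 : Eu d) R) :=
      hv.add (by fun_prop)
    obtain ⟨x, hx, hmin⟩ := (isCompact_closedBall (0 : Eu d) R).exists_isMinOn
      ⟨0, by simpa using hR⟩ hc
    have hmin' : ∀ x' ∈ Metric.closedBall (0 : Eu d) R,
      v x + κ / 2 * ‖x - y‖ ^ 2 ≤ v x' + κ / 2 * ‖x' - y‖ ^ 2 := fun x' hx' => hmin hx'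
    refine ⟨x, ⟨hx, y, hy, hmin'⟩, ?_⟩
    have hxb := (hcon y hy x hx hmin').1
    have h0 := (min_info hG hT hxb hmin').1
    have : G x = -(κ • (x - y)) := eq_neg_of_add_eq_zero_left h0
    simp only [Y, this, smul_neg, smul_smul, inv_mul_cancel₀ hκ.ne', one_smul]
    abel
  have hAb : ∀ x ∈ A, x ∈ Metric.ball (0 : Eu d) R := by
    rintro x ⟨hx, y, hy, hmin⟩
    exact (hcon y hy x hx hmin).1
  have hY : ∀ x ∈ A, HasFDerivWithinAt Y (κ⁻¹ • (T x + κ • ContinuousLinearMap.id ℝ (Eu d))) A x := by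
    intro x hx
    have h1 := (hasFDerivAt_id x).add ((hT x (hAb x hx)).const_smul κ⁻¹)
    refine HasFDerivAt.hasFDerivWithinAt ?_
    refine h1.congr_fderiv ?_
    rw [smul_add, smul_smul, inv_mul_cancel₀ hκ.ne', one_smul, add_comm]
  calc volume V ≤ volume (Y '' A) := measure_mono hsub
    _ ≤ ∫⁻ x in A, ENNReal.ofReal |(κ⁻¹ • (T x + κ • ContinuousLinearMap.id ℝ (Eu d))).det| :=
      addHaar_image_le_lintegral_abs_det_fderiv volume hA hY
    _ ≤ _ := by
      refine setLIntegral_mono' hA fun x hx => ENNReal.ofReal_le_ofReal ?_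
      obtain ⟨hxc, y, hy, hmin⟩ := hx
      obtain ⟨hxb, hh⟩ := hcon y hy x hxc hmin
      obtain ⟨h0, hp, hs⟩ := min_info hG hT hxb hmin
      have hh := hh hxb h0
      obtain ⟨l1, l2⟩ := linalg_core hδ (ha x) (κ⁻¹ • (T x + κ • ContinuousLinearMap.id ℝ (Eu d)))
        (fun ξ η => by
          rw [_root_.smul_apply, _root_.smul_apply, inner_smul_left, inner_smul_left, hs])
        (fun ξ => by
          rw [_root_.smul_apply, inner_smul_left]
          exact mul_nonneg (by simpa using hκ.le) (hp ξ))
      refine l2.trans (pow_le_pow_left₀ (div_nonneg l1 hδ.le) ?_ d)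
      rw [trA_smul, div_le_div_iff₀ hδ (by positivity)]
      have : κ⁻¹ * trA (a x) (T x + κ • ContinuousLinearMap.id ℝ (Eu d)) * (δ * κ)
        = trA (a x) (T x + κ • ContinuousLinearMap.id ℝ (Eu d)) * δ := by
        field_simp
      rw [this]
      exact mul_le_mul_of_nonneg_right hh hδ.le

end Part2

section Part3

/-- smooth supersolutions on the ball of radius `R` -/
structure Sol {d : ℕ} (δ K R : ℝ) (a : Eu d → Matrix (Fin d) (Fin d) ℝ) (b : Eu d → Eu d)
    (c : Eu d → ℝ) (w : Eu d → ℝ) (G : Eu d → Eu d) (T : Eu d → Eu d →L[ℝ] Eu d) (g : Eu d → ℝ) :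
    Prop where
  hδ : 0 < δ
  hK : 0 ≤ K
  hR : 0 < R
  hR1 : R ≤ 1
  ell : ∀ x, Ell δ (a x)
  bc : ∀ x, ‖b x‖ + c x ≤ K
  c0 : ∀ x, 0 ≤ c x
  cont : ContinuousOn w (Metric.closedBall (0 : Eu d) R)
  hG : ∀ x ∈ Metric.ball (0 : Eu d) R, HasFDerivAt w (innerSL ℝ (G x)) x
  hT : ∀ x ∈ Metric.ball (0 : Eu d) R, HasFDerivAt G (T x) x
  pde : ∀ x ∈ Metric.ball (0 : Eu d) R,
    trA (a x) (T x) + inner ℝ (b x) (G x) - c x * w x ≤ g x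

/-- Gaussian barrier -/
def gau {d : ℕ} (s μ : ℝ) (z x : Eu d) : ℝ := s * Real.exp (-(μ / 2 * ‖x - z‖ ^ 2))

/-- concave paraboloid -/
def par {d : ℕ} (α : ℝ) (p x1 x : Eu d) : ℝ := inner ℝ p (x - x1) - α / 2 * ‖x - x1‖ ^ 2

lemma gau_nonneg {d : ℕ} {s μ : ℝ} (hs : 0 ≤ s) (z x : Eu d) : 0 ≤ gau s μ z x :=
  mul_nonneg hs (Real.exp_pos _).le

lemma gau_le {d : ℕ} {s μ : ℝ} (hs : 0 ≤ s) (hμ : 0 ≤ μ) (z x : Eu d) : gau s μ z x ≤ s := by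
  have : Real.exp (-(μ / 2 * ‖x - z‖ ^ 2)) ≤ 1 := by
    rw [Real.exp_le_one_iff]; have : 0 ≤ μ / 2 * ‖x - z‖ ^ 2 := by positivity
    linarith
  calc gau s μ z x ≤ s * 1 := mul_le_mul_of_nonneg_left this hs
    _ = s := mul_one s

def gauHess {d : ℕ} (s μ : ℝ) (z x : Eu d) : Eu d →L[ℝ] Eu d :=
  (μ ^ 2 * gau s μ z x) • (innerSL ℝ (x - z)).smulRight (x - z)
    + (-(μ * gau s μ z x)) • ContinuousLinearMap.id ℝ (Eu d)

lemma hasFDerivAt_gau {d : ℕ} (s μ : ℝ) (z x : Eu d) :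
    HasFDerivAt (gau s μ z) (innerSL ℝ ((-(μ * gau s μ z x)) • (x - z))) x := by
  have h1 := ((hasFDerivAt_halfsq μ z x).neg.exp).const_mul s
  refine h1.congr_fderiv ?_
  ext ξ
  simp [gau]
  ring

lemma hasFDerivAt_gau_grad {d : ℕ} (s μ : ℝ) (z x : Eu d) :
    HasFDerivAt (fun x => (-(μ * gau s μ z x)) • (x - z)) (gauHess s μ z x) x := by
  have h1 := (((hasFDerivAt_gau s μ z x).const_mul μ).neg).smul ((hasFDerivAt_id x).sub_const z)
  refine h1.congr_fderiv ?_
  ext ξ i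
  simp [gauHess]
  ring

lemma hasFDerivAt_par {d : ℕ} (α : ℝ) (p x1 x : Eu d) :
    HasFDerivAt (par α p x1) (innerSL ℝ (p - α • (x - x1))) x := by
  have h0 : HasFDerivAt (fun x : Eu d => innerSL ℝ p (x - x1)) ((innerSL ℝ p).comp (ContinuousLinearMap.id ℝ (Eu d))) x :=
    (innerSL ℝ p).hasFDerivAt.comp x ((hasFDerivAt_id x).sub_const x1)
  have h1 := h0.sub (hasFDerivAt_halfsq α x1 x)
  refine h1.congr_fderiv ?_
  ext ξ
  simp

lemma trA_smulRight {d : ℕ} {a : Matrix (Fin d) (Fin d) ℝ} (p : Eu d) :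
    trA a ((innerSL ℝ p).smulRight p) = ∑ i, ∑ j, a i j * p i * p j := by
  simp only [trA]
  refine Finset.sum_congr rfl fun i _ => Finset.sum_congr rfl fun j _ => ?_
  simp [EuclideanSpace.inner_single_right]
  ring

lemma barrier_contact {d : ℕ} {δ K R : ℝ} {a : Eu d → Matrix (Fin d) (Fin d) ℝ} {b : Eu d → Eu d}
    {c : Eu d → ℝ} {w : Eu d → ℝ} {G : Eu d → Eu d} {T : Eu d → Eu d →L[ℝ] Eu d} {g : Eu d → ℝ}
    (S : Sol δ K R a b c w G T g) {α κ s μ : ℝ} (hα : 0 ≤ α) (hκ : 0 < κ) (hs : 0 ≤ s) (hμ : 0 ≤ μ)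
    {p x1 z : Eu d} (hx1 : ‖x1‖ ≤ 1) {V : Set (Eu d)} (hV : IsCompact V) (hV1 : ∀ y ∈ V, ‖y‖ ≤ 1)
    (h : Eu d → ℝ)
    (hcon : ∀ y ∈ V, ∀ x ∈ Metric.closedBall (0 : Eu d) R,
      (∀ x' ∈ Metric.closedBall (0 : Eu d) R,
      (w x - par α p x1 x - gau s μ z x) + κ / 2 * ‖x - y‖ ^ 2 ≤
        (w x' - par α p x1 x' - gau s μ z x') + κ / 2 * ‖x' - y‖ ^ 2) →
      x ∈ Metric.ball (0 : Eu d) R ∧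
      g x + c x * w x + K * ‖p‖ + (α + κ) * (2 * K + d / δ)
        - gau s μ z x * (μ * (μ * δ * ‖x - z‖ ^ 2 - d / δ - K * ‖x - z‖)) ≤ h x) :
    volume V ≤ ∫⁻ x in contactSet (fun x => w x - par α p x1 x - gau s μ z x) R κ V,
      ENNReal.ofReal ((h x / (δ * κ)) ^ d) := by
  have cgau : Continuous (gau s μ z) :=
    continuous_iff_continuousAt.2 fun x => (hasFDerivAt_gau s μ z x).continuousAt
  have cpar : Continuous (par α p x1) :=
    continuous_iff_continuousAt.2 fun x => (hasFDerivAt_par α p x1 x).continuousAt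
  refine contact_lemma S.hδ S.ell
    (v := fun x => w x - par α p x1 x - gau s μ z x)
    (G := fun x => G x - (p - α • (x - x1)) - (-(μ * gau s μ z x)) • (x - z))
    (T := fun x => T x - (-(α • ContinuousLinearMap.id ℝ (Eu d))) - gauHess s μ z x)
    S.hR.le hκ ?_ ?_ ?_ hV h ?_
  · exact (S.cont.sub cpar.continuousOn).sub cgau.continuousOn
  · intro x hx
    have := ((S.hG x hx).sub (hasFDerivAt_par α p x1 x)).sub (hasFDerivAt_gau s μ z x)
    rw [map_sub, map_sub]
    exact this
  · intro x hx
    have h1 : HasFDerivAt (fun x : Eu d => p - α • (x - x1)) (-(α • ContinuousLinearMap.id ℝ (Eu d))) x :=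
      (((hasFDerivAt_id x).sub_const x1).const_smul α).const_sub p
    exact ((S.hT x hx).sub h1).sub (hasFDerivAt_gau_grad s μ z x)
  · intro y hy x hx hmin
    obtain ⟨hxb, hh⟩ := hcon y hy x hx hmin
    refine ⟨hxb, fun _ h0 => le_trans ?_ hh⟩
    have hxn : ‖x‖ ≤ 1 := (mem_closedBall_zero_iff.1 hx).trans S.hR1
    set φ := gau s μ z x with hφ
    have hφ0 : 0 ≤ φ := gau_nonneg hs z x
    have hGx : G x = (p - α • (x - x1)) + (-(μ * φ)) • (x - z) - κ • (x - y) := by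
      have := eq_neg_of_add_eq_zero_left h0
      rw [sub_eq_iff_eq_add, sub_eq_iff_eq_add] at this
      rw [this]; abel
    have hpde := S.pde x hxb
    have hbK : ‖b x‖ ≤ K := by linarith [S.bc x, S.c0 x]
    have hin : inner ℝ (b x) (G x) = inner ℝ (b x) p - α * inner ℝ (b x) (x - x1)
        - μ * φ * inner ℝ (b x) (x - z) - κ * inner ℝ (b x) (x - y) := by
      rw [hGx]
      simp only [inner_sub_right, inner_add_right, inner_smul_right, inner_neg_right, neg_smul]
      ring
    have cs : ∀ q : Eu d, |inner ℝ (b x) q| ≤ K * ‖q‖ := fun q =>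
      (abs_real_inner_le_norm _ _).trans (mul_le_mul_of_nonneg_right hbK (norm_nonneg q))
    have b1 := (abs_le.1 (cs p)).1
    have n2 : ‖x - x1‖ ≤ 2 := (norm_sub_le _ _).trans (by linarith)
    have n4 : ‖x - y‖ ≤ 2 := (norm_sub_le _ _).trans (by linarith [hV1 y hy])
    have b2 : inner ℝ (b x) (x - x1) ≤ K * 2 :=
      (abs_le.1 (cs (x - x1))).2.trans (mul_le_mul_of_nonneg_left n2 S.hK)
    have b3 := (abs_le.1 (cs (x - z))).2
    have b4 : inner ℝ (b x) (x - y) ≤ K * 2 :=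
      (abs_le.1 (cs (x - y))).2.trans (mul_le_mul_of_nonneg_left n4 S.hK)
    have b2' := mul_le_mul_of_nonneg_left b2 hα
    have b4' := mul_le_mul_of_nonneg_left b4 hκ.le
    have b3' := mul_le_mul_of_nonneg_left b3 (mul_nonneg hμ hφ0)
    have etr : trA (a x) (T x - (-(α • ContinuousLinearMap.id ℝ (Eu d))) - gauHess s μ z x
        + κ • ContinuousLinearMap.id ℝ (Eu d))
        = trA (a x) (T x) + (α + κ + μ * φ) * trA (a x) (ContinuousLinearMap.id ℝ (Eu d))
          - μ ^ 2 * φ * (∑ i, ∑ j, a x i j * (x - z) i * (x - z) j) := by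
      have : T x - (-(α • ContinuousLinearMap.id ℝ (Eu d))) - gauHess s μ z x
        + κ • ContinuousLinearMap.id ℝ (Eu d) = T x + (α + κ + μ * φ) • ContinuousLinearMap.id ℝ (Eu d)
          + (-(μ ^ 2 * φ)) • (innerSL ℝ (x - z)).smulRight (x - z) := by
        rw [gauHess, ← hφ]
        module
      rw [this, trA_add, trA_add, trA_smul, trA_smul, trA_smulRight]
      ring
    have t1 := trA_id_le (S.ell x)
    have t2 := (S.ell x (x - z)).1
    have t1' := mul_le_mul_of_nonneg_left t1 (by positivity : 0 ≤ α + κ + μ * φ)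
    have t2' := mul_le_mul_of_nonneg_left t2 (by positivity : 0 ≤ μ ^ 2 * φ)
    rw [etr]
    rw [hin] at hpde
    nlinarith [hpde, b1, b2', b3', b4', t1', t2']

end Part3

section Part4

/-- volume of the unit ball -/
def om (d : ℕ) : ℝ := (volume (Metric.ball (0 : Eu d) 1)).toReal

lemma om_pos (d : ℕ) : 0 < om d :=
  ENNReal.toReal_pos (Metric.measure_ball_pos volume _ one_pos).ne' measure_ball_lt_top.ne

lemma vol_closedBall {d : ℕ} (x : Eu d) {r : ℝ} (hr : 0 ≤ r) :
    volume (Metric.closedBall x r) = ENNReal.ofReal (r ^ d * om d) := by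
  rw [Measure.addHaar_closedBall _ _ hr, ENNReal.ofReal_mul (by positivity), om,
    ENNReal.ofReal_toReal measure_ball_lt_top.ne]
  simp

/-- integral of `g₊ ^ d` -/
def Ig {d : ℕ} (A : Set (Eu d)) (g : Eu d → ℝ) : ℝ≥0∞ :=
  ∫⁻ x in A, ENNReal.ofReal ((max (g x) 0) ^ d)

lemma Sol.add_const {d : ℕ} {δ K R : ℝ} {a : Eu d → Matrix (Fin d) (Fin d) ℝ} {b : Eu d → Eu d}
    {c : Eu d → ℝ} {w : Eu d → ℝ} {G : Eu d → Eu d} {T : Eu d → Eu d →L[ℝ] Eu d} {g : Eu d → ℝ}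
    (S : Sol δ K R a b c w G T g) {M : ℝ} (hM : 0 ≤ M) :
    Sol δ K R a b c (fun x => w x + M) G T g where
  hδ := S.hδ
  hK := S.hK
  hR := S.hR
  hR1 := S.hR1
  ell := S.ell
  bc := S.bc
  c0 := S.c0
  cont := S.cont.add continuousOn_const
  hG := fun x hx => (S.hG x hx).add_const M
  hT := S.hT
  pde := fun x hx => by
    have := S.pde x hx
    have h2 := mul_nonneg (S.c0 x) hM
    nlinarith

set_option maxHeartbeats 800000 in
lemma abp_bound {d : ℕ} (hd : 1 ≤ d) (δ K : ℝ) (hδ : 0 < δ) (hK : 0 ≤ K) : ∃ C0 : ℝ, 0 < C0 ∧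
    ∀ {R : ℝ} {a : Eu d → Matrix (Fin d) (Fin d) ℝ} {b : Eu d → Eu d}
    {c : Eu d → ℝ} {w : Eu d → ℝ} {G : Eu d → Eu d} {T : Eu d → Eu d →L[ℝ] Eu d} {g : Eu d → ℝ}
    (_ : Sol δ K R a b c w G T g) {M : ℝ} (_ : 0 < M)
    (_ : ∀ x ∈ Metric.sphere (0 : Eu d) R, -M ≤ w x)
    (_ : Ig (Metric.ball 0 R) g ≤ ENNReal.ofReal (M ^ d)),
    ∀ x ∈ Metric.closedBall (0 : Eu d) R, -(C0 * M) ≤ w x := by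
  set ω := om d with hω
  have hω0 : 0 < ω := om_pos d
  set k0 : ℝ := (1 + 1 / ω) / δ with hk0
  have hk0p : 0 < k0 := by positivity
  set lam : ℝ := (d / δ + 3 * K + 1) / δ with hlam
  have hlamp : 0 < lam := by positivity
  set c1 : ℝ := lam * Real.exp (-(lam / 2 * 9)) with hc1
  have hc1p : 0 < c1 := by positivity
  set Q : ℝ := 2 * K + d / δ + 1 with hQ
  have hQp : 0 < Q := by positivity
  refine ⟨1 + k0 * (Q / c1 + 2), by positivity, ?_⟩
  intro R a b c w G T g S M hM hbd hg x0 hx0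
  by_contra hlt
  push Not at hlt
  have S' := S.add_const hM.le
  set κ := M * k0 with hκ
  have hκp : 0 < κ := by positivity
  set t := κ * Q / c1 with ht
  have htp : 0 < t := by positivity
  have hm : w x0 + M < -(t + 2 * κ) := by
    have : t + 2 * κ + M = (1 + k0 * (Q / c1 + 2)) * M := by rw [ht, hκ]; ring
    linarith
  have hd0 : 0 < d := hd
  set z : Eu d := EuclideanSpace.single ⟨0, hd0⟩ (2 : ℝ) with hz
  have hzn : ‖z‖ = 2 := by simp [hz]
  have hpar : ∀ x : Eu d, par 0 0 0 x = 0 := by intro x; simp [par]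
  have key := barrier_contact S' (α := 0) (κ := κ) (s := t) (μ := lam) (p := 0) (x1 := 0) (z := z)
    le_rfl hκp htp.le hlamp.le (by simp) (isCompact_closedBall (0 : Eu d) 1)
    (fun y hy => mem_closedBall_zero_iff.1 hy) (fun x => max (g x) 0)
  have hmain : ∀ y ∈ Metric.closedBall (0 : Eu d) 1, ∀ x ∈ Metric.closedBall (0 : Eu d) R,
      (∀ x' ∈ Metric.closedBall (0 : Eu d) R,
      (w x + M - par 0 0 0 x - gau t lam z x) + κ / 2 * ‖x - y‖ ^ 2 ≤
        (w x' + M - par 0 0 0 x' - gau t lam z x') + κ / 2 * ‖x' - y‖ ^ 2) →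
      x ∈ Metric.ball (0 : Eu d) R ∧
      g x + c x * (w x + M) + K * ‖(0 : Eu d)‖ + (0 + κ) * (2 * K + d / δ)
        - gau t lam z x * (lam * (lam * δ * ‖x - z‖ ^ 2 - d / δ - K * ‖x - z‖)) ≤ max (g x) 0 := by
    intro y hy x hx hmin
    have h1 := hmin x0 hx0
    rw [hpar, hpar] at h1
    have hx0n : ‖x0‖ ≤ 1 := (mem_closedBall_zero_iff.1 hx0).trans S.hR1
    have hxn : ‖x‖ ≤ 1 := (mem_closedBall_zero_iff.1 hx).trans S.hR1
    have hyn : ‖y‖ ≤ 1 := mem_closedBall_zero_iff.1 hy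
    have n1 : ‖x0 - y‖ ≤ 2 := (norm_sub_le _ _).trans (by linarith)
    have n2 : κ / 2 * ‖x0 - y‖ ^ 2 ≤ 2 * κ := by
      have : ‖x0 - y‖ ^ 2 ≤ 2 ^ 2 := pow_le_pow_left₀ (norm_nonneg _) n1 2
      nlinarith
    have n3 : 0 ≤ κ / 2 * ‖x - y‖ ^ 2 := by positivity
    have g1 := gau_le htp.le hlamp.le z x
    have g2 := gau_nonneg (μ := lam) htp.le z x0
    have hneg : w x + M < 0 := by linarith
    have hxb : x ∈ Metric.ball (0 : Eu d) R := by
      rw [mem_ball_zero_iff]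
      refine lt_of_le_of_ne (mem_closedBall_zero_iff.1 hx) fun he => ?_
      have := hbd x (mem_sphere_zero_iff_norm.2 he)
      linarith
    refine ⟨hxb, ?_⟩
    have l1 : 1 ≤ ‖x - z‖ := by
      have := norm_sub_norm_le z x
      rw [norm_sub_rev]; linarith
    have l2 : ‖x - z‖ ≤ 3 := (norm_sub_le _ _).trans (by linarith)
    have l3 : 1 ≤ ‖x - z‖ ^ 2 := by nlinarith
    have l4 : ‖x - z‖ ^ 2 ≤ 9 := by nlinarith [norm_nonneg (x - z)]
    have e1 : lam * δ = d / δ + 3 * K + 1 := by rw [hlam]; field_simp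
    have e2 : 1 ≤ lam * δ * ‖x - z‖ ^ 2 - d / δ - K * ‖x - z‖ := by
      have h5 : lam * δ * 1 ≤ lam * δ * ‖x - z‖ ^ 2 := mul_le_mul_of_nonneg_left l3 (by positivity)
      have h6 : K * ‖x - z‖ ≤ K * 3 := mul_le_mul_of_nonneg_left l2 hK
      linarith
    have e3 : t * Real.exp (-(lam / 2 * 9)) ≤ gau t lam z x := by
      refine mul_le_mul_of_nonneg_left (Real.exp_le_exp.2 ?_) htp.le
      have : lam / 2 * ‖x - z‖ ^ 2 ≤ lam / 2 * 9 := mul_le_mul_of_nonneg_left l4 (by positivity)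
      linarith
    have e4 : t * c1 ≤ gau t lam z x * (lam * (lam * δ * ‖x - z‖ ^ 2 - d / δ - K * ‖x - z‖)) := by
      calc t * c1 = (t * Real.exp (-(lam / 2 * 9))) * (lam * 1) := by rw [hc1]; ring
        _ ≤ _ := by
          refine mul_le_mul e3 (mul_le_mul_of_nonneg_left e2 hlamp.le) (by positivity)
            (gau_nonneg htp.le z x)
    have e5 : t * c1 = κ * Q := by rw [ht]; field_simp
    have e6 : c x * (w x + M) ≤ 0 := mul_nonpos_of_nonneg_of_nonpos (S.c0 x) hneg.le
    have e7 := le_max_left (g x) 0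
    have e11 : (0 + κ) * (2 * K + d / δ) ≤ κ * Q := by
      rw [zero_add]
      exact mul_le_mul_of_nonneg_left (by rw [hQ]; linarith) hκp.le
    rw [norm_zero, mul_zero]
    linarith
  have key2 := key hmain
  have hsub : contactSet (fun x => w x + M - par 0 0 0 x - gau t lam z x) R κ (Metric.closedBall 0 1)
      ⊆ Metric.ball 0 R := by
    rintro x ⟨hx, y, hy, hmin⟩
    exact (hmain y hy x hx hmin).1
  rw [vol_closedBall _ zero_le_one, one_pow, one_mul] at key2
  have h2 : ENNReal.ofReal ω ≤ ENNReal.ofReal ((1 / (δ * κ)) ^ d * M ^ d) := by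
    refine key2.trans ((lintegral_mono_set hsub).trans ?_)
    have e : ∀ x, ENNReal.ofReal ((max (g x) 0 / (δ * κ)) ^ d)
        = ENNReal.ofReal ((1 / (δ * κ)) ^ d) * ENNReal.ofReal ((max (g x) 0) ^ d) := by
      intro x
      rw [← ENNReal.ofReal_mul (by positivity), ← mul_pow]
      congr 2; ring
    simp_rw [e]
    rw [lintegral_const_mul' _ _ ENNReal.ofReal_ne_top, ENNReal.ofReal_mul (by positivity)]
    gcongr
    exact hg
  rw [ENNReal.ofReal_le_ofReal_iff (by positivity), ← mul_pow] at h2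
  have e8 : 1 / (δ * κ) * M = ω / (ω + 1) := by
    rw [hκ, hk0]; field_simp
  rw [e8] at h2
  have e9 : (ω / (ω + 1)) ^ d ≤ (ω / (ω + 1)) ^ 1 :=
    pow_le_pow_of_le_one (by positivity) (by rw [div_le_one (by positivity)]; linarith) hd
  have e10 : ω / (ω + 1) < ω := by
    rw [div_lt_iff₀ (by positivity)]; nlinarith
  rw [pow_one] at e9
  linarith

end Part4

section Part5

/-- points touched from below by paraboloids of opening `α` -/
def touch {d : ℕ} (w : Eu d → ℝ) (R α : ℝ) : Set (Eu d) :=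
  {x | x ∈ Metric.closedBall (0 : Eu d) R ∧ ∃ p : Eu d, ‖p‖ ≤ α ∧
    ∀ x' ∈ Metric.closedBall (0 : Eu d) R, w x + par α p x x' ≤ w x'}

lemma touch_mono {d : ℕ} {w : Eu d → ℝ} {R α β : ℝ} (h : α ≤ β) : touch w R α ⊆ touch w R β := by
  rintro x ⟨hx, p, hp, hh⟩
  refine ⟨hx, p, hp.trans h, fun x' hx' => le_trans ?_ (hh x' hx')⟩
  simp only [par]
  have : α / 2 * ‖x' - x‖ ^ 2 ≤ β / 2 * ‖x' - x‖ ^ 2 :=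
    mul_le_mul_of_nonneg_right (by linarith) (by positivity)
  linarith

lemma isClosed_touch {d : ℕ} {w : Eu d → ℝ} {R α : ℝ}
    (hw : ContinuousOn w (Metric.closedBall (0 : Eu d) R)) : IsClosed (touch w R α) := by
  set B := Metric.closedBall (0 : Eu d) R
  set V := Metric.closedBall (0 : Eu d) α
  have hK : IsCompact (B ×ˢ V) := (isCompact_closedBall _ _).prod (isCompact_closedBall _ _)
  have hc : ∀ x' : Eu d, ContinuousOn (fun q : Eu d × Eu d => w q.1 + par α q.2 q.1 x') (B ×ˢ V) := by
    intro x'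
    have h1 : ContinuousOn (fun p : Eu d × Eu d => w p.1) (B ×ˢ V) :=
      hw.comp continuousOn_fst (fun p hp => hp.1)
    have h2 : Continuous (fun q : Eu d × Eu d => par α q.2 q.1 x') := by
      unfold par; fun_prop
    exact h1.add h2.continuousOn
  have himg : touch w R α = Prod.fst '' ((B ×ˢ V) ∩ ⋂ x' ∈ B, ((B ×ˢ V) ∩
      (fun q : Eu d × Eu d => w q.1 + par α q.2 q.1 x') ⁻¹' Set.Iic (w x'))) := by
    ext x
    constructor
    · rintro ⟨hx, p, hp, h⟩
      have hm : (x, p) ∈ B ×ˢ V := ⟨hx, by simpa [V] using hp⟩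
      refine ⟨(x, p), ⟨hm, ?_⟩, rfl⟩
      simp only [mem_iInter]
      exact fun x' hx' => ⟨hm, h x' hx'⟩
    · rintro ⟨⟨x, p⟩, ⟨⟨hx, hp⟩, h⟩, rfl⟩
      simp only [mem_iInter] at h
      exact ⟨hx, p, by simpa [V] using hp, fun x' hx' => (h x' hx').2⟩
  rw [himg]
  refine IsCompact.isClosed (IsCompact.image ?_ continuous_fst)
  refine hK.inter_right (isClosed_biInter fun x' _ => ?_)
  exact (hc x').preimage_isClosed_of_isClosed hK.isClosed isClosed_Iic

lemma sq_expand {d : ℕ} (x x' y : Eu d) :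
    ‖x' - y‖ ^ 2 = ‖x - y‖ ^ 2 + 2 * inner ℝ (x - y) (x' - x) + ‖x' - x‖ ^ 2 := by
  have : x' - y = (x - y) + (x' - x) := by abel
  rw [this, norm_add_sq_real]

lemma gau_semiconvex {d : ℕ} {s μ : ℝ} (hs : 0 ≤ s) (hμ : 0 ≤ μ) (z x x' : Eu d) :
    gau s μ z x + inner ℝ ((-(μ * gau s μ z x)) • (x - z)) (x' - x) - s * μ / 2 * ‖x' - x‖ ^ 2
      ≤ gau s μ z x' := by
  set S := μ / 2 * ‖x - z‖ ^ 2 with hS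
  set D := μ * inner ℝ (x - z) (x' - x) + μ / 2 * ‖x' - x‖ ^ 2 with hD
  have h1 : gau s μ z x' = gau s μ z x * Real.exp (-D) := by
    simp only [gau]
    rw [mul_assoc, ← Real.exp_add, sq_expand x x' z]
    congr 2
    rw [hD]; ring
  have h2 := Real.add_one_le_exp (-D)
  have h3 := mul_le_mul_of_nonneg_left h2 (gau_nonneg (μ := μ) hs z x)
  have h4 := gau_le hs hμ z x
  have h5 : gau s μ z x * (μ / 2 * ‖x' - x‖ ^ 2) ≤ s * (μ / 2 * ‖x' - x‖ ^ 2) :=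
    mul_le_mul_of_nonneg_right h4 (by positivity)
  rw [h1, inner_smul_left]
  simp only [conj_trivial]
  have h6 : gau s μ z x * (-D + 1) = gau s μ z x - gau s μ z x * (μ * inner ℝ (x - z) (x' - x))
     - gau s μ z x * (μ / 2 * ‖x' - x‖ ^ 2) := by rw [hD]; ring
  rw [h6] at h3
  linarith

/-- contact points of the barrier problem are touched by paraboloids -/
lemma contact_touch {d : ℕ} {w : Eu d → ℝ} {R α s μ r Λ : ℝ} (hR1 : R ≤ 1) (hα : 0 ≤ α)
    (hs : 0 ≤ s) (hμ : 0 ≤ μ) {p x1 z x y : Eu d} (hp : ‖p‖ ≤ α) (hx1 : ‖x1‖ ≤ 1) (hy : ‖y‖ ≤ 1)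
    (hz : ‖x - z‖ ≤ 2 * r) (hr : r ≤ 1) (hΛ : 5 * α + 2 * (s * μ) ≤ Λ)
    (hx : x ∈ Metric.closedBall (0 : Eu d) R)
    (hmin : ∀ x' ∈ Metric.closedBall (0 : Eu d) R,
      (w x - par α p x1 x - gau s μ z x) + α / 2 * ‖x - y‖ ^ 2 ≤
        (w x' - par α p x1 x' - gau s μ z x') + α / 2 * ‖x' - y‖ ^ 2) :
    x ∈ touch w R Λ := by
  have hxn : ‖x‖ ≤ 1 := (mem_closedBall_zero_iff.1 hx).trans hR1
  set φ := gau s μ z x with hφ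
  have hφ0 : 0 ≤ φ := gau_nonneg hs z x
  have hφs : φ ≤ s := gau_le hs hμ z x
  have n2 : ‖x - x1‖ ≤ 2 := (norm_sub_le _ _).trans (by linarith)
  have n4 : ‖x - y‖ ≤ 2 := (norm_sub_le _ _).trans (by linarith)
  have hsμ : 0 ≤ s * μ := mul_nonneg hs hμ
  refine ⟨hx, p - α • (x - x1) + (-(μ * φ)) • (x - z) - α • (x - y), ?_, fun x' hx' => ?_⟩
  · have m1 : ‖α • (x - x1)‖ ≤ α * 2 := by
      rw [norm_smul, Real.norm_of_nonneg hα]; exact mul_le_mul_of_nonneg_left n2 hα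
    have m2 : ‖α • (x - y)‖ ≤ α * 2 := by
      rw [norm_smul, Real.norm_of_nonneg hα]; exact mul_le_mul_of_nonneg_left n4 hα
    have m3 : ‖(-(μ * φ)) • (x - z)‖ ≤ (s * μ) * 2 := by
      rw [norm_smul, norm_neg, Real.norm_of_nonneg (mul_nonneg hμ hφ0)]
      refine mul_le_mul ?_ (by linarith) (norm_nonneg _) hsμ
      rw [mul_comm]; exact mul_le_mul_of_nonneg_right hφs hμ
    have t1 := norm_sub_le (p - α • (x - x1) + (-(μ * φ)) • (x - z)) (α • (x - y))
    have t2 := norm_add_le (p - α • (x - x1)) ((-(μ * φ)) • (x - z))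
    have t3 := norm_sub_le p (α • (x - x1))
    linarith
  · have h1 := hmin x' hx'
    have h2 := gau_semiconvex hs hμ z x x'
    rw [← hφ] at h2
    simp only [par] at h1 ⊢
    rw [sq_expand x x' y, sq_expand x x' x1] at h1
    have e1 : inner ℝ p (x' - x1) = inner ℝ p (x - x1) + inner ℝ p (x' - x) := by
      rw [← inner_add_right]; congr 1; abel
    rw [e1] at h1
    rw [inner_sub_left, inner_add_left, inner_sub_left, real_inner_smul_left (x - x1),
      real_inner_smul_left (x - y)]
    have h3 : (2 * α + s * μ) / 2 * ‖x' - x‖ ^ 2 ≤ Λ / 2 * ‖x' - x‖ ^ 2 :=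
      mul_le_mul_of_nonneg_right (by linarith) (by positivity)
    nlinarith

end Part5

section Part6

lemma w_touch_le {d : ℕ} {w : Eu d → ℝ} {R α : ℝ} (hR : 0 < R) (hR1 : R ≤ 1)
    (hw0 : w 0 ≤ 1) (hα : 1 ≤ α) {x p : Eu d} (hx : x ∈ Metric.closedBall (0 : Eu d) R) (hp : ‖p‖ ≤ α)
    (h : ∀ x' ∈ Metric.closedBall (0 : Eu d) R, w x + par α p x x' ≤ w x') : w x ≤ 5 / 2 * α := by
  have hxn : ‖x‖ ≤ 1 := (mem_closedBall_zero_iff.1 hx).trans hR1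
  have h0 := h 0 (by simpa using hR.le)
  simp only [par, zero_sub, norm_neg, inner_neg_right] at h0
  have h1 : inner ℝ p x ≤ α * 1 := (real_inner_le_norm p x).trans
    (mul_le_mul hp hxn (norm_nonneg _) (by linarith))
  have h2 : α / 2 * ‖x‖ ^ 2 ≤ α / 2 * 1 :=
    mul_le_mul_of_nonneg_left (by nlinarith [norm_nonneg x]) (by linarith)
  linarith

set_option maxHeartbeats 1600000 in
lemma doubling {d : ℕ} (δ K : ℝ) (hδ : 0 < δ) (hK : 0 ≤ K) : ∃ Λ C : ℝ, 2 ≤ Λ ∧ 0 < C ∧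
    ∀ {R : ℝ} {a : Eu d → Matrix (Fin d) (Fin d) ℝ} {b : Eu d → Eu d}
    {c : Eu d → ℝ} {w : Eu d → ℝ} {G : Eu d → Eu d} {T : Eu d → Eu d →L[ℝ] Eu d} {g : Eu d → ℝ}
    (_ : Sol δ K R a b c w G T g)
    (_ : ∀ x ∈ Metric.closedBall (0 : Eu d) R, 0 ≤ w x) (_ : w 0 ≤ 1)
    {α : ℝ} (_ : 1 ≤ α) {x1 : Eu d} (_ : x1 ∈ touch w R α) {z : Eu d} {r : ℝ} (_ : 0 < r)
    (_ : ‖x1 - z‖ ≤ r) (_ : ‖z‖ + 2 * r ≤ R),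
    ENNReal.ofReal (r ^ d) ≤ ENNReal.ofReal C * volume (touch w R (Λ * α) ∩ Metric.closedBall z (r / 8))
      + ENNReal.ofReal (C / α ^ d) * Ig (Metric.ball z (2 * r)) g := by
  set lam : ℝ := 64 * (d / δ + 3 * K + 1) / δ + 1 with hlam
  have hlam1 : 1 ≤ lam := by
    have : 0 ≤ 64 * (d / δ + 3 * K + 1) / δ := by positivity
    linarith
  have hlamp : 0 < lam := by linarith
  set C1 : ℝ := 12 * K + 2 * (d / δ) + 1 with hC1
  have hC1p : 0 < C1 := by positivity
  set E1 : ℝ := Real.exp (-(lam / 2)) - Real.exp (-(2 * lam)) with hE1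
  have hE1p : 0 < E1 := by
    rw [hE1, sub_pos]; exact Real.exp_lt_exp.2 (by linarith)
  set M : ℝ := C1 * Real.exp (2 * lam) + 3 / E1 with hM
  have hMp : 0 < M := by positivity
  have hM1 : C1 ≤ M * Real.exp (-(2 * lam)) := by
    have h1 : M * Real.exp (-(2 * lam)) = C1 + 3 / E1 * Real.exp (-(2 * lam)) := by
      rw [hM, add_mul, mul_assoc, ← Real.exp_add]; simp
    rw [h1]; have : 0 < 3 / E1 * Real.exp (-(2 * lam)) := by positivity
    linarith
  have hM2 : 2 < M * E1 := by
    have h1 : M * E1 = C1 * Real.exp (2 * lam) * E1 + 3 := by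
      rw [hM, add_mul]; congr 1; field_simp
    rw [h1]; have : 0 < C1 * Real.exp (2 * lam) * E1 := by positivity
    linarith
  set C2 : ℝ := C1 + K * M + M * lam * (d / δ + 2 * K) with hC2
  have hC2p : 0 < C2 := by positivity
  set ω := om d
  have hω0 : 0 < ω := om_pos d
  set Λ : ℝ := 5 + 2 * (M * lam) with hΛ
  set Cg : ℝ := 2 ^ (d - 1) * (1 / δ) ^ d with hCg
  set Cv : ℝ := 2 ^ (d - 1) * (C2 / δ) ^ d with hCv
  have hCgp : 0 < Cg := by positivity
  have hCvp : 0 < Cv := by positivity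
  refine ⟨Λ, (Cg + Cv) / ω, ?_, by positivity, ?_⟩
  · have : 0 < M * lam := by positivity
    rw [hΛ]; linarith
  intro R a b c w G T g S hw hw0 α hα x1 hx1 z r hr hx1z hzR
  obtain ⟨hx1b, p, hp, htouch⟩ := hx1
  have hα0 : 0 < α := by linarith
  have hR1 := S.hR1
  have hr1 : r ≤ 1 / 2 := by have := norm_nonneg z; linarith
  have hx1n : ‖x1‖ ≤ 1 := (mem_closedBall_zero_iff.1 hx1b).trans S.hR1
  have hwx1 : w x1 ≤ 5 / 2 * α := w_touch_le S.hR hR1 hw0 hα hx1b hp htouch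
  set s : ℝ := α * r ^ 2 * M with hs
  have hsp : 0 < s := by positivity
  set μ : ℝ := lam / r ^ 2 with hμ
  have hμp : 0 < μ := by positivity
  have hsμ : s * μ = α * (M * lam) := by rw [hs, hμ]; field_simp
  have hr2 : r ^ 2 ≤ 1 := by nlinarith
  have hμ1 : 1 ≤ μ := by
    rw [hμ, le_div_iff₀ (by positivity)]; linarith
  have hμr : μ * r ^ 2 = lam := by rw [hμ]; field_simp
  have hsM : s ≤ α * M := by
    rw [hs]
    have : α * r ^ 2 * M = (α * M) * r ^ 2 := by ring
    rw [this]
    exact mul_le_of_le_one_right (by positivity) hr2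
  have hVn : ∀ y ∈ Metric.closedBall z r, ‖y‖ ≤ 1 := by
    intro y hy
    have h1 : ‖y - z‖ ≤ r := by simpa [dist_eq_norm] using hy
    have h2 : ‖y‖ ≤ ‖y - z‖ + ‖z‖ := by simpa using norm_add_le (y - z) z
    linarith
  set h : Eu d → ℝ := fun x => max (g x) 0 + (Metric.closedBall z (r / 8)).indicator (fun _ => C2 * α) x
    with hh
  have hmain : ∀ y ∈ Metric.closedBall z r, ∀ x ∈ Metric.closedBall (0 : Eu d) R,
      (∀ x' ∈ Metric.closedBall (0 : Eu d) R,
      (w x - par α p x1 x - gau s μ z x) + α / 2 * ‖x - y‖ ^ 2 ≤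
        (w x' - par α p x1 x' - gau s μ z x') + α / 2 * ‖x' - y‖ ^ 2) →
      x ∈ Metric.ball z (2 * r) ∧
      g x + c x * w x + K * ‖p‖ + (α + α) * (2 * K + d / δ)
        - gau s μ z x * (μ * (μ * δ * ‖x - z‖ ^ 2 - d / δ - K * ‖x - z‖)) ≤ h x := by
    intro y hy x hx hmin
    have hyz : ‖y - z‖ ≤ r := by simpa [dist_eq_norm] using hy
    have h1 := hmin x1 hx1b
    have hp0 : par α p x1 x1 = 0 := by simp [par]
    rw [hp0] at h1
    have n1 : ‖x1 - y‖ ≤ 2 * r := by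
      have : x1 - y = (x1 - z) - (y - z) := by abel
      rw [this]; exact (norm_sub_le _ _).trans (by linarith)
    have n2 : α / 2 * ‖x1 - y‖ ^ 2 ≤ 2 * α * r ^ 2 := by
      have k0 : ‖x1 - y‖ ^ 2 ≤ (2 * r) ^ 2 := pow_le_pow_left₀ (norm_nonneg _) n1 2
      have k1 := mul_le_mul_of_nonneg_left k0 (by positivity : 0 ≤ α / 2)
      linarith only [k1]
    have n3 : 0 ≤ α / 2 * ‖x - y‖ ^ 2 := by positivity
    set φ := gau s μ z x with hφ
    have hφ0 : 0 ≤ φ := gau_nonneg hsp.le z x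
    have hφs : φ ≤ s := gau_le hsp.le hμp.le z x
    have hφ1 : s * Real.exp (-(lam / 2)) ≤ gau s μ z x1 := by
      refine mul_le_mul_of_nonneg_left (Real.exp_le_exp.2 ?_) hsp.le
      have : ‖x1 - z‖ ^ 2 ≤ r ^ 2 := pow_le_pow_left₀ (norm_nonneg _) hx1z 2
      have := mul_le_mul_of_nonneg_left this (by positivity : 0 ≤ μ / 2)
      linarith
    have hxb : x ∈ Metric.ball z (2 * r) := by
      by_contra hc
      have hc' : 2 * r ≤ ‖x - z‖ := by
        simpa [dist_eq_norm] using hc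
      have hφ2 : φ ≤ s * Real.exp (-(2 * lam)) := by
        refine mul_le_mul_of_nonneg_left (Real.exp_le_exp.2 ?_) hsp.le
        have : (2 * r) ^ 2 ≤ ‖x - z‖ ^ 2 := pow_le_pow_left₀ (by linarith) hc' 2
        have := mul_le_mul_of_nonneg_left this (by positivity : 0 ≤ μ / 2)
        linarith
      have ht := htouch x hx
      have h3 : s * E1 ≤ 2 * α * r ^ 2 := by
        rw [hE1, mul_sub]; linarith
      have h4 : s * E1 = (α * r ^ 2) * (M * E1) := by rw [hs]; ring
      have h5 : (α * r ^ 2) * 2 < (α * r ^ 2) * (M * E1) :=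
        mul_lt_mul_of_pos_left hM2 (by positivity)
      linarith
    refine ⟨hxb, ?_⟩
    have hxz : ‖x - z‖ < 2 * r := by simpa [dist_eq_norm] using hxb
    have hxz0 := norm_nonneg (x - z)
    have hxn : ‖x‖ ≤ 1 := (mem_closedBall_zero_iff.1 hx).trans S.hR1
    have hwx0 := hw x hx
    have hcK : c x ≤ K := by linarith [S.bc x, norm_nonneg (b x)]
    have hpar : par α p x1 x ≤ 2 * α := by
      have k1 : inner ℝ p (x - x1) ≤ α * 2 := (real_inner_le_norm _ _).trans
        (mul_le_mul hp ((norm_sub_le _ _).trans (by linarith)) (norm_nonneg _) hα0.le)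
      have k2 : 0 ≤ α / 2 * ‖x - x1‖ ^ 2 := by positivity
      simp only [par]; linarith
    have hwx : w x ≤ 13 / 2 * α + φ := by
      have k1 : 0 ≤ gau s μ z x1 := gau_nonneg hsp.le z x1
      have k2 : α * r ^ 2 ≤ α * 1 := mul_le_mul_of_nonneg_left hr2 hα0.le
      linarith
    have hcw : c x * w x ≤ K * (13 / 2 * α + φ) := mul_le_mul hcK hwx hwx0 hK
    have hKp : K * ‖p‖ ≤ K * α := mul_le_mul_of_nonneg_left hp hK
    have hgx := le_max_left (g x) 0
    have hdδ : 0 ≤ (d : ℝ) / δ := by positivity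
    have hKxz : K * ‖x - z‖ ≤ K * 1 := mul_le_mul_of_nonneg_left (by linarith) hK
    have hφμ0 : 0 ≤ φ * μ := by positivity
    by_cases hin : x ∈ Metric.closedBall z (r / 8)
    · have e0 : h x = max (g x) 0 + C2 * α := by simp only [hh, indicator_of_mem hin]
      rw [e0]
      have e1 : -(d / δ + 2 * K) ≤ μ * δ * ‖x - z‖ ^ 2 - d / δ - K * ‖x - z‖ := by
        have : 0 ≤ μ * δ * ‖x - z‖ ^ 2 := by positivity
        linarith
      have e2 := mul_le_mul_of_nonneg_left e1 hφμ0
      have e3 : φ * μ * (d / δ + 2 * K) ≤ α * (M * lam) * (d / δ + 2 * K) := by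
        refine mul_le_mul_of_nonneg_right ?_ (by positivity)
        rw [← hsμ]; exact mul_le_mul_of_nonneg_right hφs hμp.le
      have e4 : K * φ ≤ K * (α * M) := mul_le_mul_of_nonneg_left (hφs.trans hsM) hK
      have e5 : C2 * α = C1 * α + K * (α * M) + α * (M * lam) * (d / δ + 2 * K) := by rw [hC2]; ring
      have e6 : K * (13 / 2 * α) + K * α + (α + α) * (2 * K + d / δ) ≤ C1 * α := by
        have k0 : 0 ≤ K * α := mul_nonneg hK hα0.le
        have k1 : C1 * α - (K * (13 / 2 * α) + K * α + (α + α) * (2 * K + d / δ)) = K * α / 2 + α := by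
          rw [hC1]; ring
        linarith only [k0, k1, hα0]
      have e7 : φ * (μ * (μ * δ * ‖x - z‖ ^ 2 - d / δ - K * ‖x - z‖))
        = φ * μ * (μ * δ * ‖x - z‖ ^ 2 - d / δ - K * ‖x - z‖) := by ring
      rw [e7, e5]
      linarith
    · have e0 : h x = max (g x) 0 := by simp only [hh, indicator_of_notMem hin, add_zero]
      rw [e0]
      have hxz8 : r / 8 < ‖x - z‖ := by simpa [dist_eq_norm] using hin
      have e1 : K + 1 ≤ μ * δ * ‖x - z‖ ^ 2 - d / δ - K * ‖x - z‖ := by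
        have k1 : (r / 8) ^ 2 ≤ ‖x - z‖ ^ 2 := pow_le_pow_left₀ (by positivity) hxz8.le 2
        have k2 := mul_le_mul_of_nonneg_left k1 (by positivity : 0 ≤ μ * δ)
        have k3 : μ * δ * (r / 8) ^ 2 = lam * δ / 64 := by rw [← hμr]; ring
        have k4 : lam * δ / 64 = (d / δ + 3 * K + 1) + δ / 64 := by rw [hlam]; field_simp
        linarith
      have e2 := mul_le_mul_of_nonneg_left e1 hφμ0
      have e3 : φ * K ≤ φ * μ * K := by
        refine mul_le_mul_of_nonneg_right ?_ hK
        exact le_mul_of_one_le_right hφ0 hμ1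
      have e4 : s * Real.exp (-(2 * lam)) ≤ φ := by
        refine mul_le_mul_of_nonneg_left (Real.exp_le_exp.2 ?_) hsp.le
        have : ‖x - z‖ ^ 2 ≤ (2 * r) ^ 2 := pow_le_pow_left₀ hxz0 hxz.le 2
        have := mul_le_mul_of_nonneg_left this (by positivity : 0 ≤ μ / 2)
        linarith
      have e5 : α * C1 ≤ φ * μ := by
        have k1 := mul_le_mul_of_nonneg_right e4 hμp.le
        have k2 : s * Real.exp (-(2 * lam)) * μ = α * (M * Real.exp (-(2 * lam))) * lam := by
          calc _ = (s * μ) * Real.exp (-(2 * lam)) := by ring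
            _ = _ := by rw [hsμ]; ring
        have k3 : α * C1 ≤ α * (M * Real.exp (-(2 * lam))) := mul_le_mul_of_nonneg_left hM1 hα0.le
        have k4 : α * (M * Real.exp (-(2 * lam))) ≤ α * (M * Real.exp (-(2 * lam))) * lam :=
          le_mul_of_one_le_right (by positivity) hlam1
        linarith
      have e6 : K * (13 / 2 * α) + K * α + (α + α) * (2 * K + d / δ) ≤ α * C1 := by
        have k0 : 0 ≤ K * α := mul_nonneg hK hα0.le
        have k1 : α * C1 - (K * (13 / 2 * α) + K * α + (α + α) * (2 * K + d / δ)) = K * α / 2 + α := by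
          rw [hC1]; ring
        linarith only [k0, k1, hα0]
      have e7 : φ * (μ * (μ * δ * ‖x - z‖ ^ 2 - d / δ - K * ‖x - z‖))
        = φ * μ * (μ * δ * ‖x - z‖ ^ 2 - d / δ - K * ‖x - z‖) := by ring
      rw [e7]
      linarith
  have hballR : Metric.ball z (2 * r) ⊆ Metric.ball 0 R := by
    intro x hx
    have h1 : ‖x - z‖ < 2 * r := by simpa [dist_eq_norm] using hx
    have h2 : ‖x‖ ≤ ‖x - z‖ + ‖z‖ := by simpa using norm_add_le (x - z) z
    rw [mem_ball_zero_iff]; linarith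
  have key := barrier_contact S (α := α) (κ := α) (s := s) (μ := μ) (p := p) (x1 := x1) (z := z)
    hα0.le hα0 hsp.le hμp.le hx1n (isCompact_closedBall z r) hVn h
    (fun y hy x hx hmin => ⟨hballR (hmain y hy x hx hmin).1, (hmain y hy x hx hmin).2⟩)
  set A := contactSet (fun x => w x - par α p x1 x - gau s μ z x) R α (Metric.closedBall z r) with hA
  have hA1 : A ⊆ Metric.ball z (2 * r) := by
    rintro x ⟨hx, y, hy, hmin⟩
    exact (hmain y hy x hx hmin).1
  have hA2 : A ⊆ touch w R (Λ * α) := by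
    intro x hxA
    have hxz : ‖x - z‖ ≤ 2 * r := by
      have := hA1 hxA
      rw [Metric.mem_ball, dist_eq_norm] at this
      exact this.le
    obtain ⟨hx, y, hy, hmin⟩ := hxA
    refine contact_touch hR1 hα0.le hsp.le hμp.le hp hx1n (hVn y hy) hxz (by linarith) ?_ hx hmin
    rw [hsμ, hΛ]; linarith
  have hintegr : volume (Metric.closedBall z r) ≤ ENNReal.ofReal (Cg / α ^ d) * Ig (Metric.ball z (2 * r)) g
      + ENNReal.ofReal Cv * volume (touch w R (Λ * α) ∩ Metric.closedBall z (r / 8)) := by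
    refine key.trans ?_
    have hpt : ∀ x, ENNReal.ofReal ((h x / (δ * α)) ^ d) ≤
        ENNReal.ofReal (Cg / α ^ d) * ENNReal.ofReal ((max (g x) 0) ^ d)
        + (Metric.closedBall z (r / 8)).indicator (fun _ => ENNReal.ofReal Cv) x := by
      intro x
      have hmx : 0 ≤ max (g x) 0 := le_max_right _ _
      rw [← ENNReal.ofReal_mul (by positivity)]
      by_cases hin : x ∈ Metric.closedBall z (r / 8)
      · rw [indicator_of_mem hin, ← ENNReal.ofReal_add (by positivity) hCvp.le]
        apply ENNReal.ofReal_le_ofReal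
        have e0 : h x / (δ * α) = max (g x) 0 / (δ * α) + C2 / δ := by
          simp only [hh, indicator_of_mem hin]; field_simp
        rw [e0]
        refine (add_pow_le (by positivity) (by positivity) d).trans (le_of_eq ?_)
        rw [hCg, hCv, mul_add, div_pow, mul_pow, div_pow, div_pow, one_pow]
        field_simp
      · rw [indicator_of_notMem hin, add_zero]
        apply ENNReal.ofReal_le_ofReal
        have e0 : h x / (δ * α) = max (g x) 0 / (δ * α) := by
          simp only [hh, indicator_of_notMem hin, add_zero]
        rw [e0, hCg]
        have e1 : (max (g x) 0 / (δ * α)) ^ d = 1 * ((1 / δ) ^ d / α ^ d * max (g x) 0 ^ d) := by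
          rw [div_pow, mul_pow, div_pow, one_pow]; field_simp
        have e2 : 2 ^ (d - 1) * (1 / δ) ^ d / α ^ d * max (g x) 0 ^ d
          = 2 ^ (d - 1) * ((1 / δ) ^ d / α ^ d * max (g x) 0 ^ d) := by ring
        rw [e1, e2]
        exact mul_le_mul_of_nonneg_right (one_le_pow₀ (by norm_num)) (by positivity)
    have hmi : Measurable ((Metric.closedBall z (r / 8)).indicator (fun _ => ENNReal.ofReal Cv)) :=
      measurable_const.indicator Metric.isClosed_closedBall.measurableSet
    refine (lintegral_mono hpt).trans ?_
    rw [lintegral_add_right _ hmi, lintegral_const_mul' _ _ ENNReal.ofReal_ne_top]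
    gcongr
    · exact lintegral_mono_set hA1
    · rw [lintegral_indicator Metric.isClosed_closedBall.measurableSet, lintegral_const,
        Measure.restrict_restrict Metric.isClosed_closedBall.measurableSet,
        Measure.restrict_apply_univ]
      refine mul_le_mul' le_rfl (measure_mono ?_)
      intro x hx
      exact ⟨hA2 hx.2, hx.1⟩
  rw [vol_closedBall z hr.le, mul_comm, ENNReal.ofReal_mul hω0.le] at hintegr
  have hω' : ENNReal.ofReal ω⁻¹ * ENNReal.ofReal ω = 1 := by
    rw [← ENNReal.ofReal_mul (by positivity), inv_mul_cancel₀ hω0.ne', ENNReal.ofReal_one]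
  calc ENNReal.ofReal (r ^ d) = ENNReal.ofReal ω⁻¹ * (ENNReal.ofReal ω * ENNReal.ofReal (r ^ d)) := by
        rw [← mul_assoc, hω', one_mul]
    _ ≤ ENNReal.ofReal ω⁻¹ * (ENNReal.ofReal (Cg / α ^ d) * Ig (Metric.ball z (2 * r)) g
      + ENNReal.ofReal Cv * volume (touch w R (Λ * α) ∩ Metric.closedBall z (r / 8))) := by
        gcongr
    _ = ENNReal.ofReal (ω⁻¹ * Cv) * volume (touch w R (Λ * α) ∩ Metric.closedBall z (r / 8))
      + ENNReal.ofReal (ω⁻¹ * (Cg / α ^ d)) * Ig (Metric.ball z (2 * r)) g := by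
        have hi : 0 ≤ ω⁻¹ := by positivity
        rw [mul_add, ENNReal.ofReal_mul (p := ω⁻¹) (q := Cv) hi,
          ENNReal.ofReal_mul (p := ω⁻¹) (q := Cg / α ^ d) hi, add_comm, mul_assoc, mul_assoc]
    _ ≤ _ := by
        have i1 : ω⁻¹ * Cv ≤ (Cg + Cv) / ω := by
          rw [div_eq_inv_mul]; exact mul_le_mul_of_nonneg_left (by linarith) (by positivity)
        have i2 : ω⁻¹ * (Cg / α ^ d) ≤ (Cg + Cv) / ω / α ^ d := by
          have : ω⁻¹ * (Cg / α ^ d) = Cg / ω / α ^ d := by field_simp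
          rw [this]
          gcongr
          linarith
        gcongr

end Part6

section Part7

/-- normalised supersolutions -/
structure NSol {d : ℕ} (δ K R : ℝ) (a : Eu d → Matrix (Fin d) (Fin d) ℝ) (b : Eu d → Eu d)
    (c : Eu d → ℝ) (w : Eu d → ℝ) (G : Eu d → Eu d) (T : Eu d → Eu d →L[ℝ] Eu d) (g : Eu d → ℝ) :
    Prop extends Sol δ K R a b c w G T g where
  hR2 : 1 / 2 ≤ R
  w_nonneg : ∀ x ∈ Metric.closedBall (0 : Eu d) R, 0 ≤ w x
  w_zero : w 0 ≤ 1
  hIg : Ig (Metric.ball (0 : Eu d) R) g ≤ 1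

lemma touch_base {d : ℕ} {w : Eu d → ℝ} {R α : ℝ} (hR : 1 / 2 ≤ R) (hR1 : R ≤ 1)
    (hc : ContinuousOn w (Metric.closedBall (0 : Eu d) R))
    (hw : ∀ x ∈ Metric.closedBall (0 : Eu d) R, 0 ≤ w x) (hw0 : w 0 ≤ 1) (hα : 512 ≤ α) :
    (touch w R α ∩ Metric.closedBall 0 (R / 8)).Nonempty := by
  have h0 : (0 : Eu d) ∈ Metric.closedBall (0 : Eu d) R := by
    simp; linarith
  obtain ⟨x, hx, hmin⟩ := (isCompact_closedBall (0 : Eu d) R).exists_isMinOn ⟨0, h0⟩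
    (f := fun x => w x + α / 2 * ‖x‖ ^ 2) (hc.add (by fun_prop))
  rw [isMinOn_iff] at hmin
  have h1 := hmin 0 h0
  simp only [norm_zero] at h1
  have h2 := hw x hx
  have h3 : 256 * ‖x‖ ^ 2 ≤ α / 2 * ‖x‖ ^ 2 := by
    apply mul_le_mul_of_nonneg_right _ (by positivity); linarith
  have h4 : ‖x‖ ≤ 1 / 16 := by
    apply le_of_sq_le_sq _ (by norm_num) <;> nlinarith
  have hxR : ‖x‖ ≤ 1 := by linarith
  refine ⟨x, ⟨hx, -(α • x), ?_, ?_⟩, ?_⟩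
  · rw [norm_neg, norm_smul, Real.norm_of_nonneg (by linarith)]
    exact mul_le_of_le_one_right (by linarith) hxR
  · intro x' hx'
    have h5 := hmin x' hx'
    have e : ‖x'‖ ^ 2 = ‖x‖ ^ 2 + 2 * inner ℝ x (x' - x) + ‖x' - x‖ ^ 2 := by
      have := norm_add_sq_real x (x' - x)
      rwa [add_sub_cancel] at this
    rw [e] at h5
    simp only [par, inner_neg_left, real_inner_smul_left]
    linarith
  · rw [mem_closedBall_zero_iff]; linarith

lemma chain {d : ℕ} (hd : 1 ≤ d) {δ K Λ C : ℝ} (hΛ : 2 ≤ Λ) (hC : 0 < C)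
    {R : ℝ} {a : Eu d → Matrix (Fin d) (Fin d) ℝ} {b : Eu d → Eu d}
    {c : Eu d → ℝ} {w : Eu d → ℝ} {G : Eu d → Eu d} {T : Eu d → Eu d →L[ℝ] Eu d} {g : Eu d → ℝ}
    (S : NSol δ K R a b c w G T g)
    (hdoub : ∀ {α : ℝ} (_ : 1 ≤ α) {x1 : Eu d} (_ : x1 ∈ touch w R α) {z : Eu d} {r : ℝ} (_ : 0 < r)
      (_ : ‖x1 - z‖ ≤ r) (_ : ‖z‖ + 2 * r ≤ R),
      ENNReal.ofReal (r ^ d) ≤ ENNReal.ofReal C * volume (touch w R (Λ * α) ∩ Metric.closedBall z (r / 8))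
      + ENNReal.ofReal (C / α ^ d) * Ig (Metric.ball z (2 * r)) g)
    {α0 : ℝ} (hα0 : 512 + 16 * (C + 1) ≤ α0) (k : ℕ) :
    ∀ x : Eu d, ‖x‖ < R → R * (3 / 4) ^ k ≤ R - ‖x‖ →
      (touch w R (α0 * Λ ^ k) ∩ Metric.closedBall x ((R - ‖x‖) / 8)).Nonempty := by
  have hR := S.hR
  induction k with
  | zero =>
    intro x hx h
    have : ‖x‖ = 0 := by
      have := norm_nonneg x
      simp only [pow_zero, mul_one] at h; linarith
    rw [norm_eq_zero] at this
    subst this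
    simpa using touch_base S.hR2 S.hR1 S.cont S.w_nonneg S.w_zero (by linarith : 512 ≤ α0)
  | succ k ih =>
    intro x hx h
    set D := R - ‖x‖ with hD
    have hDp : 0 < D := by linarith
    have hx1 : ∃ x1 ∈ touch w R (α0 * Λ ^ k), ‖x1 - x‖ ≤ D / 2 := by
      by_cases hc : ‖x‖ ≤ D / 3
      · obtain ⟨x1, h1, h2⟩ := ih 0 (by simpa using hR) (by
          simp only [norm_zero, sub_zero]
          exact mul_le_of_le_one_right hR.le (pow_le_one₀ (by norm_num) (by norm_num)))
        refine ⟨x1, h1, ?_⟩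
        simp only [norm_zero, sub_zero, mem_closedBall_zero_iff] at h2
        refine (norm_sub_le _ _).trans ?_
        linarith
      · push Not at hc
        have hxp : 0 < ‖x‖ := by linarith
        have hq : 0 ≤ 1 - D / (3 * ‖x‖) := by
          rw [sub_nonneg, div_le_one (by positivity)]; linarith
        have hn : ‖(1 - D / (3 * ‖x‖)) • x‖ = ‖x‖ - D / 3 := by
          rw [norm_smul, Real.norm_of_nonneg hq]; field_simp
        obtain ⟨x1, h1, h2⟩ := ih ((1 - D / (3 * ‖x‖)) • x) (by rw [hn]; linarith) (by
          rw [hn]; rw [pow_succ] at h; linarith)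
        refine ⟨x1, h1, ?_⟩
        rw [Metric.mem_closedBall, dist_eq_norm, hn] at h2
        have e : x1 - x = (x1 - (1 - D / (3 * ‖x‖)) • x) - (D / (3 * ‖x‖)) • x := by
          rw [sub_smul, one_smul]; abel
        have e2 : ‖(D / (3 * ‖x‖)) • x‖ = D / 3 := by
          rw [norm_smul, Real.norm_of_nonneg (by positivity)]; field_simp
        rw [e]
        refine (norm_sub_le _ _).trans ?_
        rw [e2]; linarith
    obtain ⟨x1, hx1, hx1n⟩ := hx1
    have hΛk : 1 ≤ Λ ^ k := one_le_pow₀ (by linarith)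
    have hα : 1 ≤ α0 * Λ ^ k := by nlinarith
    have key := hdoub hα hx1 (z := x) (r := D / 2) (by linarith) hx1n (by linarith)
    by_contra hne
    rw [not_nonempty_iff_eq_empty] at hne
    have hemp : touch w R (Λ * (α0 * Λ ^ k)) ∩ Metric.closedBall x (D / 2 / 8) = ∅ := by
      rw [← subset_empty_iff, ← hne]
      refine inter_subset_inter (le_of_eq ?_) (Metric.closedBall_subset_closedBall (by linarith))
      rw [pow_succ]; congr 1; ring
    rw [hemp, measure_empty, mul_zero, zero_add] at key
    have hIg : Ig (Metric.ball x (2 * (D / 2))) g ≤ 1 := by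
      refine le_trans (lintegral_mono_set ?_) S.hIg
      apply Metric.ball_subset_ball'
      rw [dist_zero_right]; linarith
    have key2 : ENNReal.ofReal ((D / 2) ^ d) ≤ ENNReal.ofReal (C / (α0 * Λ ^ k) ^ d) := by
      refine key.trans (mul_le_of_le_one_right' hIg)
    have hαp : 0 < α0 * Λ ^ k := by linarith
    rw [ENNReal.ofReal_le_ofReal_iff (by positivity), le_div_iff₀ (by positivity), ← mul_pow] at key2
    have h5 : C + 1 ≤ D / 2 * (α0 * Λ ^ k) := by
      have h6 : (3 / 4 : ℝ) ^ (k + 1) / 2 ≤ D := by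
        refine le_trans ?_ h
        have : (0 : ℝ) < (3 / 4) ^ (k + 1) := by positivity
        nlinarith [S.hR2]
      have h7 : (1 : ℝ) ≤ (3 / 4) ^ k * Λ ^ k := by
        rw [← mul_pow]; exact one_le_pow₀ (by linarith)
      have h8 : D / 2 * (α0 * Λ ^ k) ≥ (3 / 4 : ℝ) ^ (k + 1) / 2 / 2 * (α0 * Λ ^ k) := by
        gcongr
      have h9 : (3 / 4 : ℝ) ^ (k + 1) / 2 / 2 * (α0 * Λ ^ k) = (3 / 16 * α0) * ((3 / 4) ^ k * Λ ^ k) := by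
        rw [pow_succ]; ring
      have h10 : (3 / 16 * α0) * 1 ≤ (3 / 16 * α0) * ((3 / 4) ^ k * Λ ^ k) :=
        mul_le_mul_of_nonneg_left h7 (by linarith)
      linarith
    have h6 : D / 2 * (α0 * Λ ^ k) ≤ (D / 2 * (α0 * Λ ^ k)) ^ d :=
      le_self_pow₀ (by linarith) (by omega)
    linarith

set_option maxHeartbeats 800000 in
lemma covering {d : ℕ} {δ K Λ C : ℝ} (hΛ : 2 ≤ Λ) (hC : 0 < C)
    {R : ℝ} {a : Eu d → Matrix (Fin d) (Fin d) ℝ} {b : Eu d → Eu d}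
    {c : Eu d → ℝ} {w : Eu d → ℝ} {G : Eu d → Eu d} {T : Eu d → Eu d →L[ℝ] Eu d} {g : Eu d → ℝ}
    (S : NSol δ K R a b c w G T g)
    (hdoub : ∀ {α : ℝ} (_ : 1 ≤ α) {x1 : Eu d} (_ : x1 ∈ touch w R α) {z : Eu d} {r : ℝ} (_ : 0 < r)
      (_ : ‖x1 - z‖ ≤ r) (_ : ‖z‖ + 2 * r ≤ R),
      ENNReal.ofReal (r ^ d) ≤ ENNReal.ofReal C * volume (touch w R (Λ * α) ∩ Metric.closedBall z (r / 8))
      + ENNReal.ofReal (C / α ^ d) * Ig (Metric.ball z (2 * r)) g)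
    {α t : ℝ} (hα : 1 ≤ α) (ht : 0 < t)
    (hchain : ∀ x : Eu d, ‖x‖ < R → t ≤ R - ‖x‖ →
      (touch w R α ∩ Metric.closedBall x ((R - ‖x‖) / 8)).Nonempty) :
    volume (Metric.closedBall (0 : Eu d) (R - t) \ touch w R α) ≤
      ENNReal.ofReal (om d * 10 ^ d * C) *
        volume (Metric.ball (0 : Eu d) R ∩ (touch w R (Λ * α) \ touch w R α))
      + ENNReal.ofReal (om d * 10 ^ d * C / α ^ d) := by
  have hR := S.hR
  set A := touch w R α with hA
  have hAc : IsClosed A := isClosed_touch S.cont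
  set E := Metric.closedBall (0 : Eu d) (R - t) \ A with hE
  set ρ : Eu d → ℝ := fun x => Metric.infDist x A with hρ
  have hEx : ∀ x ∈ E, t ≤ R - ‖x‖ := by
    intro x hx
    have := mem_closedBall_zero_iff.1 hx.1
    linarith
  have hE1 : ∀ x ∈ E, 0 < ρ x ∧ ρ x ≤ (R - ‖x‖) / 8 ∧ ∃ x1 ∈ A, ‖x1 - x‖ ≤ ρ x := by
    intro x hx
    obtain ⟨y, hyA, hy⟩ := hchain x (by linarith [hEx x hx]) (hEx x hx)
    refine ⟨(hAc.notMem_iff_infDist_pos ⟨y, hyA⟩).1 hx.2, ?_, ?_⟩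
    · refine (Metric.infDist_le_dist_of_mem hyA).trans ?_
      rw [dist_comm]; exact hy
    · obtain ⟨x1, h1, h2⟩ := hAc.exists_infDist_eq_dist ⟨y, hyA⟩ x
      refine ⟨x1, h1, ?_⟩
      simp only [hρ]
      rw [h2, dist_comm, dist_eq_norm]
  obtain ⟨U, hUE, hUd, hUc⟩ := Vitali.exists_disjoint_subfamily_covering_enlargement_closedBall
    E (fun x => x) (fun x => 2 * ρ x) 2 (fun x hx => by
      have h1 := (hE1 x hx).2.1
      have h2 := hEx x hx
      have := norm_nonneg x
      have := S.hR1
      linarith) 5 (by norm_num)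
  have hUcount : U.Countable := by
    refine hUd.countable_of_nonempty_interior ?_
    intro x hx
    refine ⟨x, ?_⟩
    apply Metric.ball_subset_interior_closedBall
    apply Metric.mem_ball_self
    linarith [(hE1 x (hUE hx)).1]
  set ω := om d with hω
  have hω0 : 0 < ω := om_pos d
  have hd1 : U.PairwiseDisjoint (fun x => (touch w R (Λ * α) \ A) ∩ Metric.closedBall x (ρ x / 8)) := by
    refine hUd.mono_on ?_
    intro x hx
    refine inter_subset_right.trans (Metric.closedBall_subset_closedBall ?_)
    have := (hE1 x (hUE hx)).1
    linarith
  have hd2 : U.PairwiseDisjoint (fun x => Metric.ball x (2 * ρ x)) := by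
    refine hUd.mono_on ?_
    intro x hx
    exact Metric.ball_subset_closedBall
  have hballs : ∀ x ∈ E, Metric.ball x (2 * ρ x) ⊆ Metric.ball 0 R := by
    intro x hx
    apply Metric.ball_subset_ball'
    rw [dist_zero_right]
    have := (hE1 x hx).2.1
    have := (hE1 x hx).1
    linarith
  have hsum1 : ∑' x : U, volume ((touch w R (Λ * α) \ A) ∩ Metric.closedBall (x : Eu d) (ρ x / 8)) ≤
      volume (Metric.ball (0 : Eu d) R ∩ (touch w R (Λ * α) \ A)) := by
    rw [← measure_biUnion hUcount hd1 (fun x hx =>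
      ((isClosed_touch S.cont).measurableSet.diff hAc.measurableSet).inter Metric.isClosed_closedBall.measurableSet)]
    apply measure_mono
    refine iUnion₂_subset fun x hx => ?_
    intro y hy
    refine ⟨hballs x (hUE hx) ?_, hy.1⟩
    have h0 := (hE1 x (hUE hx)).1
    exact Metric.closedBall_subset_ball (by linarith) hy.2
  have hsum2 : ∑' x : U, Ig (Metric.ball (x : Eu d) (2 * ρ x)) g ≤ 1 := by
    refine le_trans ?_ S.hIg
    unfold Ig
    rw [← lintegral_biUnion hUcount (fun x hx => Metric.isOpen_ball.measurableSet) hd2]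
    exact lintegral_mono_set (iUnion₂_subset fun x hx => hballs x (hUE hx))
  have hpt : ∀ x : U, volume (Metric.closedBall (x : Eu d) (5 * (2 * ρ x))) ≤
      ENNReal.ofReal (ω * 10 ^ d * C) * volume ((touch w R (Λ * α) \ A) ∩ Metric.closedBall (x : Eu d) (ρ x / 8))
      + ENNReal.ofReal (ω * 10 ^ d * C / α ^ d) * Ig (Metric.ball (x : Eu d) (2 * ρ x)) g := by
    rintro ⟨x, hx⟩
    obtain ⟨h0, h1, x1, hx1, hx1n⟩ := hE1 x (hUE hx)
    simp only
    have key := hdoub hα hx1 h0 hx1n (by linarith)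
    have e1 : touch w R (Λ * α) ∩ Metric.closedBall x (ρ x / 8)
        = (touch w R (Λ * α) \ A) ∩ Metric.closedBall x (ρ x / 8) := by
      ext y
      refine ⟨fun hy => ⟨⟨hy.1, fun hyA => ?_⟩, hy.2⟩, fun hy => ⟨hy.1.1, hy.2⟩⟩
      have h2 := Metric.infDist_le_dist_of_mem (x := x) hyA
      have h3 := hy.2
      rw [Metric.mem_closedBall, dist_comm] at h3
      have : ρ x ≤ ρ x / 8 := h2.trans h3
      linarith
    rw [e1] at key
    rw [vol_closedBall x (by linarith)]
    have e2 : (5 * (2 * ρ x)) ^ d * om d = (ω * 10 ^ d) * (ρ x) ^ d := by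
      rw [← hω, ← mul_assoc, mul_pow]; norm_num; ring
    have hc0 : 0 ≤ ω * 10 ^ d := by positivity
    have hα0 : 0 < α := by linarith
    rw [e2, ENNReal.ofReal_mul hc0]
    refine (mul_le_mul' le_rfl key).trans (le_of_eq ?_)
    rw [mul_add, ← mul_assoc, ← mul_assoc, ← ENNReal.ofReal_mul hc0, ← ENNReal.ofReal_mul hc0,
      mul_div_assoc]
  have hcov : E ⊆ ⋃ x ∈ U, Metric.closedBall x (5 * (2 * ρ x)) := by
    intro x hx
    obtain ⟨y, hyU, hy⟩ := hUc x hx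
    refine mem_biUnion hyU (hy ?_)
    apply Metric.mem_closedBall_self
    linarith [(hE1 x hx).1]
  calc volume E ≤ volume (⋃ x ∈ U, Metric.closedBall x (5 * (2 * ρ x))) := measure_mono hcov
    _ ≤ ∑' x : U, volume (Metric.closedBall (x : Eu d) (5 * (2 * ρ x))) := measure_biUnion_le _ hUcount _
    _ ≤ ∑' x : U, (ENNReal.ofReal (ω * 10 ^ d * C) * volume ((touch w R (Λ * α) \ A) ∩ Metric.closedBall (x : Eu d) (ρ x / 8))
      + ENNReal.ofReal (ω * 10 ^ d * C / α ^ d) * Ig (Metric.ball (x : Eu d) (2 * ρ x)) g) :=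
        ENNReal.tsum_le_tsum hpt
    _ = ENNReal.ofReal (ω * 10 ^ d * C) * ∑' x : U, volume ((touch w R (Λ * α) \ A) ∩ Metric.closedBall (x : Eu d) (ρ x / 8))
      + ENNReal.ofReal (ω * 10 ^ d * C / α ^ d) * ∑' x : U, Ig (Metric.ball (x : Eu d) (2 * ρ x)) g := by
        rw [ENNReal.tsum_add, ENNReal.tsum_mul_left, ENNReal.tsum_mul_left]
    _ ≤ _ := by
        refine add_le_add (mul_le_mul' le_rfl hsum1) ?_
        exact mul_le_of_le_one_right' hsum2

lemma layer_vol {d : ℕ} {R s : ℝ} (hR : 0 < R) (hR1 : R ≤ 1) (hs : 0 ≤ s) (hs1 : s ≤ 1) :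
    volume (Metric.ball (0 : Eu d) R \ Metric.closedBall (0 : Eu d) (R - R * s)) ≤
      ENNReal.ofReal (om d * d * s) := by
  have hRs : 0 ≤ R - R * s := by nlinarith
  have h1 : volume (Metric.ball (0 : Eu d) R \ Metric.closedBall (0 : Eu d) (R - R * s)) ≤
      volume (Metric.closedBall (0 : Eu d) R \ Metric.closedBall (0 : Eu d) (R - R * s)) :=
    measure_mono (diff_subset_diff_left Metric.ball_subset_closedBall)
  refine h1.trans ?_
  rw [measure_diff (Metric.closedBall_subset_closedBall (by nlinarith))
    Metric.isClosed_closedBall.measurableSet.nullMeasurableSet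
    (by rw [vol_closedBall _ hRs]; exact ENNReal.ofReal_ne_top),
    vol_closedBall _ hRs, vol_closedBall _ hR.le,
    ← ENNReal.ofReal_sub _ (mul_nonneg (pow_nonneg hRs d) (om_pos d).le)]
  apply ENNReal.ofReal_le_ofReal
  have e : (R - R * s) ^ d = R ^ d * (1 + -s) ^ d := by rw [← mul_pow]; ring
  have b : 1 + (d : ℝ) * (-s) ≤ (1 + -s) ^ d := one_add_mul_le_pow (by linarith) d
  have hRd : R ^ d ≤ 1 := pow_le_one₀ hR.le hR1
  have hRd0 : 0 < R ^ d := by positivity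
  have hω := om_pos d
  rw [e]
  have h2 : R ^ d * om d - R ^ d * (1 + -s) ^ d * om d = (R ^ d) * (om d * (1 - (1 + -s) ^ d)) := by ring
  rw [h2]
  have h3 : om d * (1 - (1 + -s) ^ d) ≤ om d * (d * s) :=
    mul_le_mul_of_nonneg_left (by linarith) hω.le
  calc R ^ d * (om d * (1 - (1 + -s) ^ d)) ≤ R ^ d * (om d * (d * s)) :=
        mul_le_mul_of_nonneg_left h3 hRd0.le
    _ ≤ 1 * (om d * (d * s)) := mul_le_mul_of_nonneg_right hRd (by positivity)
    _ = _ := by ring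

set_option maxHeartbeats 800000 in
lemma decay {d : ℕ} (hd : 1 ≤ d) (δ K : ℝ) (hδ : 0 < δ) (hK : 0 ≤ K) :
    ∃ Λ α0 σ B : ℝ, 2 ≤ Λ ∧ 1 ≤ α0 ∧ 0 < σ ∧ σ < 1 ∧ 0 < B ∧
    ∀ {R : ℝ} {a : Eu d → Matrix (Fin d) (Fin d) ℝ} {b : Eu d → Eu d}
    {c : Eu d → ℝ} {w : Eu d → ℝ} {G : Eu d → Eu d} {T : Eu d → Eu d →L[ℝ] Eu d} {g : Eu d → ℝ}
    (_ : NSol δ K R a b c w G T g) (k : ℕ),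
    volume (Metric.ball (0 : Eu d) R \ touch w R (α0 * Λ ^ k)) ≤ ENNReal.ofReal (B * σ ^ k) := by
  obtain ⟨Λ, C, hΛ, hC, hdoub⟩ := doubling (d := d) δ K hδ hK
  set α0 : ℝ := 512 + 16 * (C + 1) with hα0
  have hα01 : 1 ≤ α0 := by linarith
  have hω := om_pos d
  set C3 : ℝ := om d * 10 ^ d * C + 1 with hC3
  have hC3' : 0 < om d * 10 ^ d * C := by positivity
  have hC31 : 1 ≤ C3 := by linarith
  have hC30 : 0 < C3 := by linarith
  set B0 : ℝ := C3 + om d * d with hB0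
  have hB0p : 0 < B0 := by positivity
  set q : ℝ := 1 - 1 / C3 with hq
  have hq0 : 0 ≤ q := by rw [hq, sub_nonneg, div_le_one hC30]; exact hC31
  have hq1 : q < 1 := by
    have : 0 < 1 / C3 := by positivity
    linarith
  set σ : ℝ := max ((1 + q) / 2) (3 / 4) with hσ
  have hσ1 : σ < 1 := max_lt (by linarith) (by norm_num)
  have hσ34 : 3 / 4 ≤ σ := le_max_right _ _
  have hσq : (1 + q) / 2 ≤ σ := le_max_left _ _
  have hσq' : 0 < σ - q := by linarith
  set B : ℝ := om d + B0 / C3 / (σ - q) with hB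
  refine ⟨Λ, α0, σ, B, hΛ, hα01, by linarith, hσ1, by positivity, ?_⟩
  intro R a b c w G T g S k
  have hR := S.hR
  have hd' : ∀ {α : ℝ} (_ : 1 ≤ α) {x1 : Eu d} (_ : x1 ∈ touch w R α) {z : Eu d} {r : ℝ} (_ : 0 < r)
      (_ : ‖x1 - z‖ ≤ r) (_ : ‖z‖ + 2 * r ≤ R),
      ENNReal.ofReal (r ^ d) ≤ ENNReal.ofReal C * volume (touch w R (Λ * α) ∩ Metric.closedBall z (r / 8))
      + ENNReal.ofReal (C / α ^ d) * Ig (Metric.ball z (2 * r)) g :=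
    fun h1 _ h2 _ _ h3 h4 h5 => hdoub S.toSol S.w_nonneg S.w_zero h1 h2 h3 h4 h5
  have hch := chain hd hΛ hC S hd' (le_of_eq hα0.symm)
  have hfin : volume (Metric.ball (0 : Eu d) R) ≤ ENNReal.ofReal (om d) := by
    refine (measure_mono Metric.ball_subset_closedBall).trans ?_
    rw [vol_closedBall _ hR.le]
    exact ENNReal.ofReal_le_ofReal (mul_le_of_le_one_left hω.le (pow_le_one₀ hR.le S.hR1))
  have hft : ∀ s : Set (Eu d), volume (Metric.ball (0 : Eu d) R ∩ s) ≠ ⊤ := fun s =>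
    ((measure_mono inter_subset_left).trans_lt (hfin.trans_lt ENNReal.ofReal_lt_top)).ne
  have hft' : ∀ s : Set (Eu d), volume (Metric.ball (0 : Eu d) R \ s) ≠ ⊤ := fun s => by
    rw [diff_eq]; exact hft _
  set m : ℕ → ℝ := fun k => (volume (Metric.ball (0 : Eu d) R \ touch w R (α0 * Λ ^ k))).toReal with hm
  have hstep : ∀ k, m k ≤ C3 * (m k - m (k + 1)) + B0 * (3 / 4) ^ k := by
    intro k
    have hθ0 : (0 : ℝ) < (3 / 4) ^ k := by positivity
    have hθ1 : (3 / 4 : ℝ) ^ k ≤ 1 := pow_le_one₀ (by norm_num) (by norm_num)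
    have hΛk : 1 ≤ Λ ^ k := one_le_pow₀ (by linarith)
    have hα : 1 ≤ α0 * Λ ^ k := by nlinarith
    have hcov := covering hΛ hC S hd' hα (by positivity : 0 < R * (3 / 4) ^ k) (hch k)
    have hmono : touch w R (α0 * Λ ^ k) ⊆ touch w R (α0 * Λ ^ (k + 1)) := by
      apply touch_mono
      rw [pow_succ]; nlinarith
    have eΛ : Λ * (α0 * Λ ^ k) = α0 * Λ ^ (k + 1) := by rw [pow_succ]; ring
    rw [eΛ] at hcov
    set A := touch w R (α0 * Λ ^ k) with hA
    set A' := touch w R (α0 * Λ ^ (k + 1)) with hA'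
    set Bl := Metric.ball (0 : Eu d) R with hBl
    have hsplit : volume (Bl \ A) = volume (Bl \ A') + volume (Bl ∩ (A' \ A)) := by
      have hmA' : MeasurableSet A' := (isClosed_touch S.cont).measurableSet
      rw [← measure_diff_add_inter (Bl \ A) hmA']
      congr 2
      · ext x; constructor
        · rintro ⟨⟨h1, h2⟩, h3⟩; exact ⟨h1, h3⟩
        · rintro ⟨h1, h3⟩; exact ⟨⟨h1, fun h => h3 (hmono h)⟩, h3⟩
      · ext x; constructor
        · rintro ⟨⟨h1, h2⟩, h3⟩; exact ⟨h1, h3, h2⟩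
        · rintro ⟨h1, h3, h2⟩; exact ⟨⟨h1, h2⟩, h3⟩
    set v : ℝ := (volume (Bl ∩ (A' \ A))).toReal with hv
    have hv0 : 0 ≤ v := ENNReal.toReal_nonneg
    have e1 : m k = m (k + 1) + v := by
      simp only [hm]
      rw [← ENNReal.toReal_add (hft' _) (hft _), ← hsplit]
    have hαd : 1 / (α0 * Λ ^ k) ^ d ≤ (3 / 4) ^ k := by
      have h1 : α0 * Λ ^ k ≤ (α0 * Λ ^ k) ^ d := le_self_pow₀ hα (by omega)
      have h2 : (4 / 3 : ℝ) ^ k ≤ Λ ^ k := pow_le_pow_left₀ (by norm_num) (by linarith) k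
      have h3 : (4 / 3 : ℝ) ^ k ≤ (α0 * Λ ^ k) ^ d := by
        have : Λ ^ k ≤ α0 * Λ ^ k := le_mul_of_one_le_left (by linarith) hα01
        linarith
      have h4 : (3 / 4 : ℝ) ^ k = 1 / (4 / 3) ^ k := by
        rw [← one_div_pow]; norm_num
      rw [h4]
      exact one_div_le_one_div_of_le (by positivity) h3
    have hle : volume (Bl \ A) ≤ ENNReal.ofReal (C3 * v + B0 * (3 / 4) ^ k) := by
      have hsub : Bl \ A ⊆ (Metric.closedBall (0 : Eu d) (R - R * (3 / 4) ^ k) \ A) ∪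
          (Bl \ Metric.closedBall (0 : Eu d) (R - R * (3 / 4) ^ k)) := by
        rintro x ⟨h1, h2⟩
        by_cases h : x ∈ Metric.closedBall (0 : Eu d) (R - R * (3 / 4) ^ k)
        · exact Or.inl ⟨h, h2⟩
        · exact Or.inr ⟨h1, h⟩
      refine (measure_mono hsub).trans ((measure_union_le _ _).trans ?_)
      refine (add_le_add hcov (layer_vol hR S.hR1 hθ0.le hθ1)).trans ?_
      have hve : volume (Bl ∩ (A' \ A)) = ENNReal.ofReal v := (ENNReal.ofReal_toReal (hft _)).symm
      rw [hve, ← ENNReal.ofReal_mul hC3'.le, ← ENNReal.ofReal_add (by positivity) (by positivity),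
        ← ENNReal.ofReal_add (by positivity) (by positivity)]
      apply ENNReal.ofReal_le_ofReal
      have i1 : om d * 10 ^ d * C / (α0 * Λ ^ k) ^ d ≤ C3 * (3 / 4) ^ k := by
        rw [div_eq_mul_one_div]
        exact mul_le_mul (by linarith) hαd (by positivity) hC30.le
      have i2 : om d * 10 ^ d * C * v ≤ C3 * v := mul_le_mul_of_nonneg_right (by linarith) hv0
      rw [hB0, add_mul C3 (om d * d)]
      linarith
    have e2 : m k ≤ C3 * v + B0 * (3 / 4) ^ k := ENNReal.toReal_le_of_le_ofReal (by positivity) hle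
    have e3 : m k - m (k + 1) = v := by linarith
    rw [e3]; exact e2
  have hbd : ∀ k, m k ≤ B * σ ^ k := by
    intro k
    induction k with
    | zero =>
      have : m 0 ≤ om d := by
        refine ENNReal.toReal_le_of_le_ofReal hω.le ((measure_mono diff_subset).trans hfin)
      have h2 : 0 ≤ B0 / C3 / (σ - q) := by positivity
      simp only [pow_zero, mul_one]; linarith
    | succ k ih =>
      have h1 := hstep k
      have h2 : m (k + 1) ≤ q * m k + B0 / C3 * (3 / 4) ^ k := by
        have h3 : m (k + 1) * C3 ≤ (q * m k + B0 / C3 * (3 / 4) ^ k) * C3 := by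
          have : (q * m k + B0 / C3 * (3 / 4) ^ k) * C3 = (C3 - 1) * m k + B0 * (3 / 4) ^ k := by
            rw [hq]; field_simp
          rw [this]; linarith
        exact le_of_mul_le_mul_right h3 hC30
      have h4 : q * m k ≤ q * (B * σ ^ k) := mul_le_mul_of_nonneg_left ih hq0
      have h5 : (3 / 4 : ℝ) ^ k ≤ σ ^ k := pow_le_pow_left₀ (by norm_num) hσ34 k
      have h6 : B0 / C3 * (3 / 4) ^ k ≤ B0 / C3 * σ ^ k := mul_le_mul_of_nonneg_left h5 (by positivity)
      have hσp : 0 < σ ^ k := pow_pos (by linarith) k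
      have h7 : B0 / C3 ≤ B * (σ - q) := by
        have : B * (σ - q) = om d * (σ - q) + B0 / C3 := by rw [hB]; field_simp
        rw [this]; have : 0 < om d * (σ - q) := by positivity
        linarith
      have h8 := mul_le_mul_of_nonneg_right h7 hσp.le
      rw [pow_succ]
      linarith
  rw [← ENNReal.ofReal_toReal (hft' (touch w R (α0 * Λ ^ k)))]
  exact ENNReal.ofReal_le_ofReal (hbd k)

end Part7

section Part8

lemma touch_Lw {d : ℕ} {δ K R : ℝ} {a : Eu d → Matrix (Fin d) (Fin d) ℝ} {b : Eu d → Eu d}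
    {c : Eu d → ℝ} {w : Eu d → ℝ} {G : Eu d → Eu d} {T : Eu d → Eu d →L[ℝ] Eu d} {g : Eu d → ℝ}
    (S : NSol δ K R a b c w G T g) {α : ℝ} (hα : 1 ≤ α) {x : Eu d} (hx : x ∈ Metric.ball (0 : Eu d) R)
    (hxt : x ∈ touch w R α) :
    -((d / δ + 4 * K) * α) ≤ trA (a x) (T x) + inner ℝ (b x) (G x) - c x * w x := by
  obtain ⟨hxc, p, hp, ht⟩ := hxt
  have hwx := w_touch_le S.hR S.hR1 S.w_zero hα hxc hp ht
  have hK := S.hK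
  have hδ := S.hδ
  have hinfo := min_info (v := fun y => w y - par 0 p x y) (G := fun y => G y - p) (T := T) (R := R)
    (κ := α) (x := x) (y := x) ?_ ?_ hx ?_
  · obtain ⟨h1, h2, h3⟩ := hinfo
    have hGp : G x = p := by
      simp only [sub_self, smul_zero, add_zero] at h1
      exact sub_eq_zero.1 h1
    have h4 := (linalg_core S.hδ (S.ell x) _ h3 h2).1
    rw [trA_add, trA_smul] at h4
    have h5 := mul_le_mul_of_nonneg_left (trA_id_le (S.ell x)) (by linarith : 0 ≤ α)
    have hbx : ‖b x‖ ≤ K := by linarith [S.bc x, S.c0 x]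
    have hcx : c x ≤ K := by linarith [S.bc x, norm_nonneg (b x)]
    have h6 : -(K * α) ≤ inner ℝ (b x) (G x) := by
      rw [hGp]
      have := (abs_le.1 (abs_real_inner_le_norm (b x) p)).1
      have h7 : ‖b x‖ * ‖p‖ ≤ K * α := mul_le_mul hbx hp (norm_nonneg _) hK
      linarith
    have h7 : c x * w x ≤ K * (5 / 2 * α) := mul_le_mul hcx hwx (S.w_nonneg x hxc) hK
    have h8 : 0 ≤ K * α := mul_nonneg hK (by linarith)
    have h9 : (d / δ + 4 * K) * α = α * (d / δ) + 4 * (K * α) := by ring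
    rw [h9]
    linarith
  · intro y hy
    have := (S.hG y hy).sub (hasFDerivAt_par 0 p x y)
    rw [zero_smul, sub_zero] at this
    rw [map_sub]
    exact this
  · intro y hy
    exact (S.hT y hy).sub_const p
  · intro x' hx'
    have := ht x' hx'
    simp only [par] at this ⊢
    simp only [sub_self, inner_zero_right, norm_zero]
    linarith

set_option maxHeartbeats 800000 in
lemma norm_est {d : ℕ} (hd : 1 ≤ d) (δ K : ℝ) (hδ : 0 < δ) (hK : 0 ≤ K) :
    ∃ γ N : ℝ, 0 < γ ∧ γ ≤ 1 ∧ 0 < N ∧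
    ∀ {R : ℝ} {a : Eu d → Matrix (Fin d) (Fin d) ℝ} {b : Eu d → Eu d}
    {c : Eu d → ℝ} {w : Eu d → ℝ} {G : Eu d → Eu d} {T : Eu d → Eu d →L[ℝ] Eu d} {g f : Eu d → ℝ}
    (_ : NSol δ K R a b c w G T g)
    (_ : ∀ x ∈ Metric.ball (0 : Eu d) R,
      trA (a x) (T x) + inner ℝ (b x) (G x) - c x * w x ≤ g x - f x),
    ∫⁻ x in Metric.ball (0 : Eu d) R, ENNReal.ofReal (f x) ^ γ ≤ ENNReal.ofReal N := by
  obtain ⟨Λ, α0, σ, B, hΛ, hα0, hσ0, hσ1, hB, hdec⟩ := decay (d := d) hd δ K hδ hK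
  have hlΛ : 0 < Real.log Λ := Real.log_pos (by linarith)
  have hlσ : Real.log σ < 0 := Real.log_neg hσ0 hσ1
  set γ : ℝ := min 1 (-Real.log σ / (2 * Real.log Λ)) with hγ
  have hγ0 : 0 < γ := lt_min one_pos (div_pos (by linarith) (by linarith))
  have hγ1 : γ ≤ 1 := min_le_left _ _
  have hγ2 : γ * Real.log Λ ≤ -Real.log σ / 2 := by
    have h1 : γ ≤ -Real.log σ / (2 * Real.log Λ) := min_le_right _ _
    have h2 := mul_le_mul_of_nonneg_right h1 hlΛ.le
    have h3 : -Real.log σ / (2 * Real.log Λ) * Real.log Λ = -Real.log σ / 2 := by field_simp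
    linarith
  set C4 : ℝ := d / δ + 4 * K with hC4
  have hC40 : 0 ≤ C4 := by positivity
  set τ : ℝ := Λ ^ γ * σ with hτ
  have hΛ0 : 0 < Λ := by linarith
  have hτ0 : 0 < τ := by positivity
  have hτ1 : τ < 1 := by
    have e : τ = Real.exp (γ * Real.log Λ + Real.log σ) := by
      rw [hτ, Real.exp_add, Real.exp_log hσ0, Real.rpow_def_of_pos hΛ0, mul_comm γ]
    rw [e, Real.exp_lt_one_iff]; linarith
  have hω := om_pos d
  set N1 : ℝ := (C4 * (α0 * Λ)) ^ γ * B with hN1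
  have hN10 : 0 ≤ N1 := by positivity
  refine ⟨γ, (om d + 1) + (C4 * α0) ^ γ * om d + N1 * (1 - τ)⁻¹, hγ0, hγ1, ?_, ?_⟩
  · have : 0 < 1 - τ := by linarith
    positivity
  intro R a b c w G T g f S hf
  set Bl := Metric.ball (0 : Eu d) R with hBl
  have hBlm : MeasurableSet Bl := Metric.isOpen_ball.measurableSet
  have hfin : volume Bl ≤ ENNReal.ofReal (om d) := by
    refine (measure_mono Metric.ball_subset_closedBall).trans ?_
    rw [vol_closedBall _ S.hR.le]
    exact ENNReal.ofReal_le_ofReal (mul_le_of_le_one_left hω.le (pow_le_one₀ S.hR.le S.hR1))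
  set A : ℕ → Set (Eu d) := fun k => touch w R (α0 * Λ ^ k) with hA
  have hAm : ∀ k, MeasurableSet (A k) := fun k => (isClosed_touch S.cont).measurableSet
  have hdk : ∀ k, volume (Bl \ A k) ≤ ENNReal.ofReal (B * σ ^ k) := fun k => hdec S k
  have hαk : ∀ k : ℕ, 1 ≤ α0 * Λ ^ k := fun k => by
    have : 1 ≤ Λ ^ k := one_le_pow₀ (by linarith)
    nlinarith
  have hfk : ∀ k, ∀ x ∈ Bl, x ∈ A k → ENNReal.ofReal (f x) ^ γ ≤
      ENNReal.ofReal (max (g x) 0) ^ γ + ENNReal.ofReal ((C4 * (α0 * Λ ^ k)) ^ γ) := by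
    intro k x hx hxA
    have h1 := touch_Lw S (hαk k) hx hxA
    have h2 := hf x hx
    have h4 : 0 ≤ C4 * (α0 * Λ ^ k) := mul_nonneg hC40 (by linarith [hαk k])
    have h3 : ENNReal.ofReal (f x) ≤ ENNReal.ofReal (max (g x) 0) + ENNReal.ofReal (C4 * (α0 * Λ ^ k)) := by
      rw [← ENNReal.ofReal_add (le_max_right _ _) h4]
      apply ENNReal.ofReal_le_ofReal
      have := le_max_left (g x) 0
      linarith
    refine (ENNReal.rpow_le_rpow h3 hγ0.le).trans ?_
    refine (ENNReal.rpow_add_le_add_rpow _ _ hγ0.le hγ1).trans ?_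
    rw [ENNReal.ofReal_rpow_of_nonneg h4 hγ0.le]
  have hnull : volume (⋂ k, (Bl \ A k)) = 0 := by
    have ht : Filter.Tendsto (fun k : ℕ => ENNReal.ofReal (B * σ ^ k)) Filter.atTop (𝓝 0) := by
      have h1 : Filter.Tendsto (fun k : ℕ => B * σ ^ k) Filter.atTop (𝓝 (B * 0)) :=
        (tendsto_pow_atTop_nhds_zero_of_lt_one hσ0.le hσ1).const_mul B
      have := ENNReal.tendsto_ofReal h1
      simpa using this
    refine le_antisymm (ge_of_tendsto' ht fun k => ?_) zero_le
    exact (measure_mono (iInter_subset _ k)).trans (hdk k)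
  set F : Eu d → ℝ≥0∞ := fun x => ∑' k : ℕ,
    (Bl \ A k).indicator (fun _ => ENNReal.ofReal ((C4 * (α0 * Λ ^ (k + 1))) ^ γ)) x with hF
  have hmk : ∀ k : ℕ, Measurable ((Bl \ A k).indicator
      (fun _ : Eu d => ENNReal.ofReal ((C4 * (α0 * Λ ^ (k + 1))) ^ γ))) := fun k =>
    measurable_const.indicator (hBlm.diff (hAm k))
  have hFm : Measurable F := Measurable.ennreal_tsum hmk
  have hae : ∀ᵐ x ∂(volume.restrict Bl), ENNReal.ofReal (f x) ^ γ ≤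
      ENNReal.ofReal (max (g x) 0) ^ γ + (ENNReal.ofReal ((C4 * α0) ^ γ) + F x) := by
    rw [ae_restrict_iff' hBlm]
    have : ∀ᵐ x : Eu d, x ∉ ⋂ k, (Bl \ A k) := measure_eq_zero_iff_ae_notMem.1 hnull
    filter_upwards [this] with x hx hxB
    by_cases h0 : x ∈ A 0
    · have := hfk 0 x hxB h0
      rw [pow_zero, mul_one] at this
      refine this.trans ?_
      gcongr
      exact le_self_add
    · have hex : ∃ k, x ∈ A k := by
        by_contra hne
        push Not at hne
        exact hx (mem_iInter.2 fun k => ⟨hxB, hne k⟩)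
      classical
      obtain ⟨k, hk1, hk2⟩ : ∃ k, x ∉ A k ∧ x ∈ A (k + 1) := by
        by_contra hne
        push Not at hne
        have : ∀ k, x ∉ A k := by
          intro k
          induction k with
          | zero => exact h0
          | succ k ih => exact hne k ih
        obtain ⟨k, hk⟩ := hex
        exact this k hk
      refine (hfk (k + 1) x hxB hk2).trans ?_
      gcongr
      refine le_trans ?_ le_add_self
      refine le_trans ?_ (ENNReal.le_tsum k)
      rw [indicator_of_mem (show x ∈ Bl \ A k from ⟨hxB, hk1⟩)]
  refine (lintegral_mono_ae hae).trans ?_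
  rw [lintegral_add_right _ (hFm.const_add _), lintegral_add_right _ hFm, lintegral_const,
    Measure.restrict_apply_univ]
  have hg : ∫⁻ x in Bl, ENNReal.ofReal (max (g x) 0) ^ γ ≤ ENNReal.ofReal (om d + 1) := by
    have h1 : ∀ x, ENNReal.ofReal (max (g x) 0) ^ γ ≤ ENNReal.ofReal ((max (g x) 0) ^ d) + 1 := by
      intro x
      have h0 : 0 ≤ max (g x) 0 := le_max_right _ _
      rw [ENNReal.ofReal_rpow_of_nonneg h0 hγ0.le, ← ENNReal.ofReal_one,
        ← ENNReal.ofReal_add (by positivity) zero_le_one]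
      apply ENNReal.ofReal_le_ofReal
      rcases le_total (max (g x) 0) 1 with h | h
      · have : (max (g x) 0) ^ γ ≤ 1 := Real.rpow_le_one h0 h hγ0.le
        have : 0 ≤ (max (g x) 0) ^ d := by positivity
        linarith
      · have h2 : (max (g x) 0) ^ γ ≤ (max (g x) 0) ^ (1 : ℝ) := Real.rpow_le_rpow_of_exponent_le h hγ1
        rw [Real.rpow_one] at h2
        have h3 : max (g x) 0 ≤ (max (g x) 0) ^ d := le_self_pow₀ h (by omega)
        linarith
    refine (lintegral_mono h1).trans ?_
    rw [lintegral_add_right _ measurable_const, lintegral_const, one_mul, Measure.restrict_apply_univ,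
      add_comm, ENNReal.ofReal_add hω.le zero_le_one, ENNReal.ofReal_one]
    exact add_le_add hfin S.hIg
  have hFi : ∫⁻ x in Bl, F x ≤ ENNReal.ofReal (N1 * (1 - τ)⁻¹) := by
    refine (setLIntegral_le_lintegral _ _).trans ?_
    rw [lintegral_tsum (fun k => (hmk k).aemeasurable)]
    have h1 : ∀ k : ℕ, ∫⁻ x, (Bl \ A k).indicator
      (fun _ : Eu d => ENNReal.ofReal ((C4 * (α0 * Λ ^ (k + 1))) ^ γ)) x ≤ ENNReal.ofReal (N1 * τ ^ k) := by
      intro k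
      rw [lintegral_indicator (hBlm.diff (hAm k)), lintegral_const, Measure.restrict_apply_univ]
      refine (mul_le_mul' le_rfl (hdk k)).trans ?_
      rw [← ENNReal.ofReal_mul (by positivity)]
      apply ENNReal.ofReal_le_ofReal
      apply le_of_eq
      have e1 : C4 * (α0 * Λ ^ (k + 1)) = (C4 * (α0 * Λ)) * Λ ^ k := by rw [pow_succ]; ring
      have e2 : (Λ ^ k) ^ γ = (Λ ^ γ) ^ k := by
        rw [← Real.rpow_natCast, ← Real.rpow_natCast, ← Real.rpow_mul hΛ0.le, ← Real.rpow_mul hΛ0.le,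
          mul_comm]
      rw [e1, Real.mul_rpow (by positivity) (by positivity), e2, hN1, hτ, mul_pow]
      ring
    refine (ENNReal.tsum_le_tsum h1).trans ?_
    have hs : HasSum (fun k : ℕ => N1 * τ ^ k) (N1 * (1 - τ)⁻¹) :=
      (hasSum_geometric_of_lt_one hτ0.le hτ1).mul_left N1
    rw [← ENNReal.ofReal_tsum_of_nonneg (fun k => by positivity) hs.summable, hs.tsum_eq]
  have hτ' : 0 ≤ (1 - τ)⁻¹ := by rw [inv_nonneg]; linarith
  rw [add_assoc, ENNReal.ofReal_add (by positivity) (by positivity),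
    ENNReal.ofReal_add (p := (C4 * α0) ^ γ * om d) (by positivity) (by positivity)]
  refine add_le_add hg (add_le_add ?_ hFi)
  rw [ENNReal.ofReal_mul (by positivity)]
  exact mul_le_mul' le_rfl hfin

end Part8

section Part9

lemma Sol.scale {d : ℕ} {δ K R : ℝ} {a : Eu d → Matrix (Fin d) (Fin d) ℝ} {b : Eu d → Eu d}
    {c : Eu d → ℝ} {w : Eu d → ℝ} {G : Eu d → Eu d} {T : Eu d → Eu d →L[ℝ] Eu d} {g : Eu d → ℝ}
    (S : Sol δ K R a b c w G T g) {t : ℝ} (ht : 0 ≤ t) :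
    Sol δ K R a b c (fun x => t * w x) (fun x => t • G x) (fun x => t • T x) (fun x => t * g x) where
  hδ := S.hδ
  hK := S.hK
  hR := S.hR
  hR1 := S.hR1
  ell := S.ell
  bc := S.bc
  c0 := S.c0
  cont := continuousOn_const.mul S.cont
  hG := fun x hx => by
    rw [map_smul]
    exact (S.hG x hx).const_mul t
  hT := fun x hx => (S.hT x hx).const_smul t
  pde := fun x hx => by
    have := mul_le_mul_of_nonneg_left (S.pde x hx) ht
    rw [trA_smul, real_inner_smul_right]
    linarith

lemma smooth_est {d : ℕ} (hd : 1 ≤ d) (δ K : ℝ) (hδ : 0 < δ) (hK : 0 ≤ K) :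
    ∃ γ N : ℝ, 0 < γ ∧ γ ≤ 1 ∧ 0 < N ∧
    ∀ {R : ℝ} {a : Eu d → Matrix (Fin d) (Fin d) ℝ} {b : Eu d → Eu d}
    {c : Eu d → ℝ} {w : Eu d → ℝ} {G : Eu d → Eu d} {T : Eu d → Eu d →L[ℝ] Eu d} {g f : Eu d → ℝ}
    (_ : Sol δ K R a b c w G T (fun x => g x - f x)) (_ : 1 / 2 ≤ R)
    (_ : ∀ x ∈ Metric.ball (0 : Eu d) R, 0 ≤ f x)
    {s : ℝ} (_ : 0 < s) (_ : w 0 ≤ s) (_ : ∀ x ∈ Metric.sphere (0 : Eu d) R, -s ≤ w x)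
    (_ : Ig (Metric.ball 0 R) g ≤ ENNReal.ofReal (s ^ d)),
    ∫⁻ x in Metric.ball (0 : Eu d) R, ENNReal.ofReal (f x) ^ γ ≤ ENNReal.ofReal (N * s ^ γ) := by
  obtain ⟨C0, hC0, habp⟩ := abp_bound (d := d) hd δ K hδ hK
  obtain ⟨γ, N, hγ0, hγ1, hN, hest⟩ := norm_est (d := d) hd δ K hδ hK
  refine ⟨γ, N * (1 + C0) ^ γ, hγ0, hγ1, by positivity, ?_⟩
  intro R a b c w G T g f S hR2 hf s hs hw0 hws hIg
  have S' : Sol δ K R a b c w G T g := { S with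
    pde := fun x hx => by
      have := S.pde x hx
      have := hf x hx
      linarith }
  have hlow := habp S' hs hws hIg
  set P : ℝ := (1 + C0) * s with hP
  have hPp : 0 < P := by positivity
  have S1 := (S.add_const (M := C0 * s) (by positivity)).scale (t := P⁻¹) (by positivity)
  have S2 := (S'.add_const (M := C0 * s) (by positivity)).scale (t := P⁻¹) (by positivity)
  have NS : NSol δ K R a b c (fun x => P⁻¹ * (w x + C0 * s)) (fun x => P⁻¹ • G x) (fun x => P⁻¹ • T x)
      (fun x => P⁻¹ * g x) := { S2 with
    hR2 := hR2
    w_nonneg := fun x hx => mul_nonneg (by positivity) (by linarith [hlow x hx])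
    w_zero := by
      rw [inv_mul_le_iff₀ hPp, hP]; linarith
    hIg := by
      have e : ∀ x, ENNReal.ofReal ((max (P⁻¹ * g x) 0) ^ d) =
          ENNReal.ofReal (P⁻¹ ^ d) * ENNReal.ofReal ((max (g x) 0) ^ d) := by
        intro x
        rw [← ENNReal.ofReal_mul (by positivity), ← mul_pow, mul_max_of_nonneg _ _ (by positivity), mul_zero]
      unfold Ig
      simp_rw [e]
      rw [lintegral_const_mul' _ _ ENNReal.ofReal_ne_top]
      refine (mul_le_mul' le_rfl hIg).trans ?_
      rw [← ENNReal.ofReal_mul (by positivity), ← mul_pow, ENNReal.ofReal_le_one]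
      apply pow_le_one₀ (by positivity)
      rw [inv_mul_le_iff₀ hPp, hP]
      nlinarith }
  have key := hest (f := fun x => P⁻¹ * f x) NS (fun x hx => by
    have := S1.pde x hx
    linarith)
  have e : ∀ x ∈ Metric.ball (0 : Eu d) R, ENNReal.ofReal (f x) ^ γ =
      ENNReal.ofReal (P ^ γ) * ENNReal.ofReal (P⁻¹ * f x) ^ γ := by
    intro x hx
    have h0 := hf x hx
    rw [← ENNReal.ofReal_rpow_of_nonneg hPp.le hγ0.le, ← ENNReal.mul_rpow_of_nonneg _ _ hγ0.le,
      ← ENNReal.ofReal_mul hPp.le, mul_inv_cancel_left₀ hPp.ne']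
  rw [setLIntegral_congr_fun Metric.isOpen_ball.measurableSet e, lintegral_const_mul' _ _ ENNReal.ofReal_ne_top]
  refine (mul_le_mul' le_rfl key).trans (le_of_eq ?_)
  rw [← ENNReal.ofReal_mul (by positivity), hP, Real.mul_rpow (by positivity) hs.le]
  congr 1; ring

end Part9

section Part10

/-- mollification -/
def mol {d : ℕ} (φ W : Eu d → ℝ) (x : Eu d) : ℝ := ∫ t, φ t * W (x - t)

lemma integrable_mol {d : ℕ} {φ W : Eu d → ℝ} (hφ : Continuous φ) (hs : HasCompactSupport φ)
    (hW : Integrable W) (x : Eu d) : Integrable fun t => φ t * W (x - t) := by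
  obtain ⟨C, hC⟩ := hs.exists_bound_of_continuous hφ
  exact (hW.comp_sub_left x).bdd_mul hφ.aestronglyMeasurable (Filter.Eventually.of_forall hC)

lemma mol_deriv {d : ℕ} {φ : Eu d → ℝ} {ε : ℝ} (hφ : ContDiff ℝ 1 φ) (hs : HasCompactSupport φ)
    (hsupp : tsupport φ ⊆ Metric.closedBall 0 ε) {V : Eu d → ℝ} {V' : Fin d → Eu d → ℝ}
    (hV : Integrable V) (hV' : ∀ i, Integrable (V' i)) (x : Eu d)
    (h : ∀ y ∈ Metric.closedBall x ε, ∀ i, HasDerivAt (fun s : ℝ => V (y + s • eb i)) (V' i y) 0) :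
    HasFDerivAt (mol φ V) (innerSL ℝ (WithLp.toLp 2 (fun i => mol φ (V' i) x) : Eu d)) x := by
  have h1 := hs.hasFDerivAt_convolution_left (ContinuousLinearMap.mul ℝ ℝ) hφ
    (hV.locallyIntegrable) x
  have e0 : (convolution φ V (ContinuousLinearMap.mul ℝ ℝ) volume) = mol φ V := by
    ext y; simp [convolution, mol]
  rw [e0] at h1
  refine h1.congr_fderiv ?_
  have hfc : Continuous (fderiv ℝ φ) := hφ.continuous_fderiv (by norm_num)
  have hfs : HasCompactSupport (fderiv ℝ φ) := hs.fderiv ℝ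
  have hintegr : Integrable (fun t => (ContinuousLinearMap.precompL (Eu d) (ContinuousLinearMap.mul ℝ ℝ)) (fderiv ℝ φ t) (V (x - t))) := by
    exact (hfs.convolutionExists_left (ContinuousLinearMap.precompL (Eu d) (ContinuousLinearMap.mul ℝ ℝ)) hfc hV.locallyIntegrable x)
  refine ContinuousLinearMap.coe_injective ((EuclideanSpace.basisFun (Fin d) ℝ).toBasis.ext ?_)
  intro i
  simp only [OrthonormalBasis.coe_toBasis, EuclideanSpace.basisFun_apply, ContinuousLinearMap.coe_coe]
  rw [convolution, ContinuousLinearMap.integral_apply hintegr]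
  have e1 : ∀ t, ((ContinuousLinearMap.precompL (Eu d) (ContinuousLinearMap.mul ℝ ℝ)) (fderiv ℝ φ t) (V (x - t))) (EuclideanSpace.single i 1) = (fderiv ℝ φ t (eb i)) * V (x - t) := by
    intro t; simp [ContinuousLinearMap.precompL_apply]
  simp_rw [e1]
  have e2 : innerSL ℝ (WithLp.toLp 2 (fun i => mol φ (V' i) x) : Eu d) (EuclideanSpace.single i 1) = mol φ (V' i) x := by
    simp [EuclideanSpace.inner_single_right]
  rw [e2]
  have hpc : Continuous fun t => fderiv ℝ φ t (eb i) := hfc.clm_apply continuous_const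
  have hps : HasCompactSupport fun t => fderiv ℝ φ t (eb i) := hfs.comp_left (g := fun L : Eu d →L[ℝ] ℝ => L (eb i)) (by simp)
  have hb := integral_bilinear_hasLineDerivAt_right_eq_neg_left_of_integrable (μ := (volume : Measure (Eu d)))
    (f := φ) (f' := fun t => fderiv ℝ φ t (eb i)) (g := fun t => V (x - t)) (g' := fun t => - V' i (x - t))
    (v := eb i) (B := ContinuousLinearMap.mul ℝ ℝ)
    (by simpa using integrable_mol hpc hps hV x)
    (by simpa using (integrable_mol hφ.continuous hs (hV' i) x).neg)
    (by simpa using integrable_mol hφ.continuous hs hV x)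
    (fun t _ => ((hφ.differentiable (by norm_num) t).hasFDerivAt).hasLineDerivAt (eb i))
    (by
      intro t ht
      have hy : x - t ∈ Metric.closedBall x ε := by
        have := hsupp ht
        simpa [Metric.mem_closedBall, dist_eq_norm] using this
      have h3 := h _ hy i
      unfold HasLineDerivAt
      have h4 : HasDerivAt (fun s : ℝ => -s) (-1) 0 := hasDerivAt_neg 0
      have h5 := HasDerivAt.comp (0:ℝ) (h₂ := fun s : ℝ => V (x - t + s • eb i)) (h := fun s : ℝ => -s) (h₂' := V' i (x - t)) (by simpa using h3) h4
      refine (h5.congr_deriv (by ring)).congr_of_eventuallyEq (Filter.Eventually.of_forall fun s => ?_)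
      simp only [Function.comp]
      congr 1
      simp; abel)
  simp only [ContinuousLinearMap.mul_apply', mul_neg, integral_neg, neg_inj] at hb
  rw [mol, hb]

/-- the linear map with prescribed rows -/
def rows {d : ℕ} (m : Fin d → Fin d → ℝ) : Eu d →L[ℝ] Eu d :=
  (EuclideanSpace.equiv (Fin d) ℝ).symm.toContinuousLinearMap ∘L
    ContinuousLinearMap.pi fun i => innerSL ℝ (WithLp.toLp 2 (m i) : Eu d)

lemma rows_eb {d : ℕ} (m : Fin d → Fin d → ℝ) (i j : Fin d) : (rows m (eb j)) i = m i j := by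
  simp [rows, EuclideanSpace.inner_single_right]

lemma mol_deriv2 {d : ℕ} {φ : Eu d → ℝ} {ε : ℝ} (hφ : ContDiff ℝ 1 φ) (hs : HasCompactSupport φ)
    (hsupp : tsupport φ ⊆ Metric.closedBall 0 ε) {V : Fin d → Eu d → ℝ} {V' : Fin d → Fin d → Eu d → ℝ}
    (hV : ∀ i, Integrable (V i)) (hV' : ∀ i j, Integrable (V' i j)) (x : Eu d)
    (h : ∀ y ∈ Metric.closedBall x ε, ∀ i j, HasDerivAt (fun s : ℝ => V i (y + s • eb j)) (V' i j y) 0) :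
    HasFDerivAt (fun x => (WithLp.toLp 2 (fun i => mol φ (V i) x) : Eu d))
      (rows fun i j => mol φ (V' i j) x) x := by
  rw [← hasFDerivWithinAt_univ, hasFDerivWithinAt_euclidean]
  intro i
  rw [hasFDerivWithinAt_univ]
  refine (mol_deriv hφ hs hsupp (hV i) (hV' i) x fun y hy j => h y hy i j).congr_fderiv ?_
  ext v
  simp [rows]

end Part10

section Part11

lemma jensen_nat {α : Type*} [MeasurableSpace α] (ν : Measure α) [IsProbabilityMeasure ν] {d : ℕ} (hd : 1 ≤ d)
    {h : α → ℝ≥0∞} (hh : AEMeasurable h ν) : (∫⁻ x, h x ∂ν) ^ d ≤ ∫⁻ x, h x ^ d ∂ν := by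
  have h0 : (0 : ℝ) < d := by exact_mod_cast hd
  have := eLpNorm'_le_eLpNorm'_of_exponent_le (p := 1) (q := (d : ℝ)) one_pos (by exact_mod_cast hd) ν hh.aestronglyMeasurable
  simp only [eLpNorm', enorm_eq_self, ENNReal.rpow_one, ENNReal.rpow_natCast, div_one] at this
  calc _ ≤ ((∫⁻ x, h x ^ d ∂ν) ^ (1 / (d : ℝ))) ^ d := by gcongr
    _ = _ := by rw [← ENNReal.rpow_natCast, ← ENNReal.rpow_mul]; field_simp; simp

lemma trans_cont {d : ℕ} (hd : 1 ≤ d) {W : Eu d → ℝ} (hW : MemLp W d volume) {η : ℝ≥0∞} (hη : 0 < η) :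
    ∃ ε0 : ℝ, 0 < ε0 ∧ ∀ t : Eu d, ‖t‖ ≤ ε0 → ∫⁻ x, ‖W (x - t) - W x‖ₑ ^ d ≤ η := by
  have : Fact ((1 : ℝ≥0∞) ≤ (d : ℝ≥0∞)) := ⟨by exact_mod_cast hd⟩
  have : Fact ((d : ℝ≥0∞) ≠ ∞) := ⟨by simp⟩
  have hd0 : d ≠ 0 := by omega
  have hc : Continuous fun t : Eu d => (DomAddAct.mk t) +ᵥ (hW.toLp W) := by
    have : Continuous fun t : Eu d => DomAddAct.mk t := DomAddAct.continuous_mk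
    fun_prop
  have h0 : (DomAddAct.mk (0 : Eu d)) +ᵥ (hW.toLp W) = hW.toLp W := by simp
  have ht := hc.tendsto 0
  rw [h0] at ht
  have hη2 : 0 < min η 1 := by simp [hη]
  have hη3 : (0 : ℝ≥0∞) < (min η 1) ^ (1 / (d : ℝ)) := ENNReal.rpow_pos hη2 (by simp)
  have hev := EMetric.tendsto_nhds.1 ht _ hη3
  obtain ⟨ε, hε, hball⟩ := Metric.eventually_nhds_iff.1 hev
  refine ⟨ε / 2, by linarith, fun t htε => ?_⟩
  have h1 := hball (y := -t) (by simp; linarith)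
  rw [DomAddAct.mk_vadd_toLp, Lp.edist_toLp_toLp, eLpNorm_eq_lintegral_rpow_enorm_toReal (by simp [hd0]) (by simp)] at h1
  simp only [ENNReal.toReal_natCast, ENNReal.rpow_natCast] at h1
  have h2 : (∫⁻ x, ‖W (x - t) - W x‖ₑ ^ d) < min η 1 := by
    rw [ENNReal.rpow_lt_rpow_iff (by positivity)] at h1
    refine lt_of_eq_of_lt ?_ h1
    refine lintegral_congr fun x => ?_
    simp [sub_eq_neg_add]
  exact h2.le.trans (min_le_left _ _)

lemma mol_conv {d : ℕ} (hd : 1 ≤ d) {W : Eu d → ℝ} (hm : Measurable W) (hi : Integrable W) (hW : MemLp W d volume)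
    {η : ℝ≥0∞} (hη : 0 < η) :
    ∃ ε0 : ℝ, 0 < ε0 ∧ ∀ φ : Eu d → ℝ, Continuous φ → HasCompactSupport φ → (∀ x, 0 ≤ φ x) →
      ∫ x, φ x = 1 → tsupport φ ⊆ Metric.closedBall 0 ε0 →
      ∫⁻ x, ‖mol φ W x - W x‖ₑ ^ d ≤ η := by
  obtain ⟨ε0, he0, htr⟩ := trans_cont hd hW hη
  refine ⟨ε0, he0, fun φ hφ hs hp h1 hsupp => ?_⟩
  have hφi : Integrable φ := hφ.integrable_of_hasCompactSupport hs
  have hφm : Measurable fun x => ENNReal.ofReal (φ x) := by fun_prop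
  set ν := (volume : Measure (Eu d)).withDensity fun x => ENNReal.ofReal (φ x) with hν
  have : IsProbabilityMeasure ν := by
    constructor
    rw [hν, withDensity_apply _ MeasurableSet.univ, setLIntegral_univ, ← ofReal_integral_eq_lintegral_ofReal hφi (Filter.Eventually.of_forall hp), h1, ENNReal.ofReal_one]
  have hjm : Measurable fun p : Eu d × Eu d => ‖W (p.1 - p.2) - W p.1‖ₑ := by fun_prop
  have hpt : ∀ x, ‖mol φ W x - W x‖ₑ ^ d ≤ ∫⁻ t, ‖W (x - t) - W x‖ₑ ^ d ∂ν := by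
    intro x
    have hxm : Measurable fun t : Eu d => ‖W (x - t) - W x‖ₑ := by fun_prop
    refine le_trans ?_ (jensen_nat ν hd hxm.aemeasurable)
    gcongr
    have e1 : mol φ W x - W x = ∫ t, φ t * (W (x - t) - W x) := by
      simp_rw [mul_sub]
      rw [integral_sub (integrable_mol hφ hs hi x) (hφi.mul_const _), integral_mul_const, h1, one_mul, mol]
    rw [e1, hν, lintegral_withDensity_eq_lintegral_mul _ hφm hxm]
    refine (enorm_integral_le_lintegral_enorm _).trans (le_of_eq ?_)
    refine lintegral_congr fun t => ?_
    simp only [Pi.mul_apply, enorm_mul]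
    congr 1
    exact Real.enorm_of_nonneg (hp t)
  calc _ ≤ ∫⁻ x, ∫⁻ t, ‖W (x - t) - W x‖ₑ ^ d ∂ν := lintegral_mono hpt
    _ = ∫⁻ t, (∫⁻ x, ‖W (x - t) - W x‖ₑ ^ d) ∂ν := lintegral_lintegral_swap (hjm.pow_const d).aemeasurable
    _ = ∫⁻ t, ENNReal.ofReal (φ t) * ∫⁻ x, ‖W (x - t) - W x‖ₑ ^ d := by
        have : Measurable fun t : Eu d => ∫⁻ x, ‖W (x - t) - W x‖ₑ ^ d :=
          (hjm.pow_const d).lintegral_prod_left'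
        rw [hν, lintegral_withDensity_eq_lintegral_mul _ hφm this]
        rfl
    _ ≤ ∫⁻ t, ENNReal.ofReal (φ t) * η := by
        refine lintegral_mono fun t => ?_
        by_cases ht : t ∈ tsupport φ
        · have := htr t (by simpa using hsupp ht)
          dsimp only
          gcongr
        · simp [image_eq_zero_of_notMem_tsupport ht]
    _ = η := by
        rw [lintegral_mul_const _ hφm, ← ofReal_integral_eq_lintegral_ofReal hφi (Filter.Eventually.of_forall hp), h1]; simp

lemma mol_unif {d : ℕ} {φ W : Eu d → ℝ} (hφ : Continuous φ) (hs : HasCompactSupport φ) (hp : ∀ x, 0 ≤ φ x)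
    (h1 : ∫ x, φ x = 1) (hi : Integrable W) {ε η : ℝ} (hsupp : tsupport φ ⊆ Metric.closedBall 0 ε) (x : Eu d)
    (hx : ∀ t : Eu d, ‖t‖ ≤ ε → |W (x - t) - W x| ≤ η) : |mol φ W x - W x| ≤ η := by
  have hφi : Integrable φ := hφ.integrable_of_hasCompactSupport hs
  have e1 : mol φ W x - W x = ∫ t, φ t * (W (x - t) - W x) := by
    simp_rw [mul_sub]
    rw [integral_sub (integrable_mol hφ hs hi x) (hφi.mul_const _), integral_mul_const, h1, one_mul, mol]
  rw [e1, ← Real.norm_eq_abs]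
  calc _ ≤ ∫ t, φ t * η := by
        refine norm_integral_le_of_norm_le (hφi.mul_const _) (Filter.Eventually.of_forall fun t => ?_)
        rw [norm_mul, Real.norm_of_nonneg (hp t)]
        by_cases ht : t ∈ tsupport φ
        · exact mul_le_mul_of_nonneg_left (hx t (by simpa using hsupp ht)) (hp t)
        · simp [image_eq_zero_of_notMem_tsupport ht]
    _ = η := by rw [integral_mul_const, h1, one_mul]

lemma exists_mollifier {d : ℕ} {ε : ℝ} (hε : 0 < ε) : ∃ φ : Eu d → ℝ, ContDiff ℝ 1 φ ∧ HasCompactSupport φ ∧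
    (∀ x, 0 ≤ φ x) ∧ ∫ x, φ x = 1 ∧ tsupport φ ⊆ Metric.closedBall 0 ε := by
  let f : ContDiffBump (0 : Eu d) := ⟨ε / 2, ε, by linarith, by linarith⟩
  exact ⟨f.normed volume, f.contDiff_normed, f.hasCompactSupport_normed, f.nonneg_normed, f.integral_normed,
    (f.tsupport_normed_eq (μ := volume)).subset⟩

end Part11

section Part12

/-- the hypotheses of the main theorem -/
structure Dat {d : ℕ} (δ K : ℝ) (a : Eu d → Matrix (Fin d) (Fin d) ℝ) (b : Eu d → Eu d) (c u : Eu d → ℝ)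
    (du : Eu d → Eu d) (d2u : Eu d → Matrix (Fin d) (Fin d) ℝ) (f g : Eu d → ℝ) : Prop where
  hδ : 0 < δ
  hK : 0 ≤ K
  ma : ∀ i j, Measurable fun x => a x i j
  mb : ∀ i, Measurable fun x => b x i
  mc : Measurable c
  sym : ∀ x, (a x).IsSymm
  ell : ∀ x, Ell δ (a x)
  bc : ∀ x, ‖b x‖ + c x ≤ K
  c0 : ∀ x, 0 ≤ c x
  mu : Measurable u
  mdu : ∀ i, Measurable fun x => du x i
  md2u : ∀ i j, Measurable fun x => d2u x i j
  mf : Measurable f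
  mg : Measurable g
  cont : ContinuousOn u (Metric.closedBall (0 : Eu d) 1)
  hdu : ∀ x ∈ Metric.ball (0 : Eu d) 1, ∀ i,
          HasDerivAt (fun s : ℝ => u (x + s • eb i)) (du x i) 0
  hd2u : ∀ x ∈ Metric.ball (0 : Eu d) 1, ∀ i j,
          HasDerivAt (fun s : ℝ => du (x + s • eb j) i) (d2u x i j) 0
  sob : ∀ G : Set (Eu d), IsCompact G → G ⊆ Metric.ball (0 : Eu d) 1 →
          IntegrableOn (fun x => |u x| ^ (d : ℝ) + ‖du x‖ ^ (d : ℝ) + frobNorm (d2u x) ^ (d : ℝ))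
            G volume
  hf : ∀ x ∈ Metric.ball (0 : Eu d) 1, 0 ≤ f x
  pde : ∀ x ∈ Metric.ball (0 : Eu d) 1,
          (∑ i, ∑ j, a x i j * d2u x i j) + (∑ i, b x i * du x i) - c x * u x = g x - f x

lemma ell_entry {d : ℕ} {δ : ℝ} (hδ : 0 < δ) {a : Matrix (Fin d) (Fin d) ℝ} (hs : a.IsSymm) (h : Ell δ a)
    (i j : Fin d) : |a i j| ≤ δ⁻¹ := by
  have hδ' : 0 < δ⁻¹ := inv_pos.2 hδ
  have hii : ∀ i, 0 ≤ a i i ∧ a i i ≤ δ⁻¹ := by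
    intro i
    have := h (eb i)
    simp at this
    exact ⟨hδ.le.trans this.1, this.2⟩
  by_cases hij : i = j
  · subst hij
    rw [abs_of_nonneg (hii i).1]; exact (hii i).2
  have key : ∀ r s : ℝ, ∑ k, ∑ l, a k l * (r • eb i + s • eb j : Eu d) k * (r • eb i + s • eb j : Eu d) l
      = r ^ 2 * a i i + 2 * r * s * a i j + s ^ 2 * a j j := by
    intro r s
    have e1 : ∀ k l, a k l * (r • eb i + s • eb j : Eu d) k * (r • eb i + s • eb j : Eu d) l
      = r * r * (if k = i then (if l = i then a k l else 0) else 0)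
        + r * s * (if k = i then (if l = j then a k l else 0) else 0)
        + s * r * (if k = j then (if l = i then a k l else 0) else 0)
        + s * s * (if k = j then (if l = j then a k l else 0) else 0) := by
      intro k l
      simp only [PiLp.add_apply, PiLp.smul_apply, smul_eq_mul, EuclideanSpace.single_apply]
      split_ifs <;> ring
    simp_rw [e1, Finset.sum_add_distrib, ← Finset.mul_sum]
    have hsy : a j i = a i j := hs.apply i j
    simp [hsy]; ring
  have nrm : ∀ r s : ℝ, ‖(r • eb i + s • eb j : Eu d)‖ ^ 2 = r ^ 2 + s ^ 2 := by
    intro r s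
    rw [norm_add_sq_real]
    simp [norm_smul, real_inner_smul_left, real_inner_smul_right, EuclideanSpace.inner_single_right, hij]
  have h1 := h ((1:ℝ) • eb i + (1:ℝ) • eb j)
  have h2 := h ((1:ℝ) • eb i + (-1:ℝ) • eb j)
  rw [key, nrm] at h1 h2
  rw [abs_le]
  constructor <;> nlinarith [(hii i).1, (hii j).1]

lemma memLp_piece {d : ℕ} (hd : 1 ≤ d) {v F : Eu d → ℝ} (hv : Measurable v) {S : Set (Eu d)} (hS : IsCompact S)
    (hF : IntegrableOn F S volume) (hle : ∀ x, |v x| ^ (d : ℝ) ≤ F x) :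
    MemLp (S.indicator v) d volume ∧ Integrable (S.indicator v) := by
  have hSm : MeasurableSet S := hS.isClosed.measurableSet
  have h1 : MemLp v d (volume.restrict S) := by
    rw [← integrable_norm_rpow_iff hv.aestronglyMeasurable (by simp; omega) (by simp)]
    refine hF.mono' (hv.norm.pow_const _).aestronglyMeasurable (Filter.Eventually.of_forall fun x => ?_)
    have := hle x
    simp only [ENNReal.toReal_natCast, Real.norm_eq_abs] at *
    rwa [abs_of_nonneg (by positivity)]
  refine ⟨(memLp_indicator_iff_restrict hSm).2 h1, (integrable_indicator_iff hSm).2 ?_⟩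
  have : IsFiniteMeasure (volume.restrict S) := isFiniteMeasure_restrict.2 hS.measure_lt_top.ne
  exact h1.integrable (by exact_mod_cast hd)

lemma continuous_mol {d : ℕ} {φ W : Eu d → ℝ} (hφ : Continuous φ) (hs : HasCompactSupport φ)
    (hW : Integrable W) : Continuous (mol φ W) := by
  have h := hs.continuous_convolution_left (ContinuousLinearMap.mul ℝ ℝ) hφ hW.locallyIntegrable
  have e0 : (convolution φ W (ContinuousLinearMap.mul ℝ ℝ) volume) = mol φ W := by
    ext y; simp [convolution, mol]
  rwa [e0] at h

/-- index set of the derivatives of order at most two -/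
abbrev Ix (d : ℕ) := Option (Fin d ⊕ (Fin d × Fin d))

/-- derivatives -/
def pieces {d : ℕ} (u : Eu d → ℝ) (du : Eu d → Eu d) (d2u : Eu d → Matrix (Fin d) (Fin d) ℝ) : Ix d → Eu d → ℝ
  | none => u
  | some (Sum.inl i) => fun x => du x i
  | some (Sum.inr p) => fun x => d2u x p.1 p.2

/-- coefficients -/
def coefs {d : ℕ} (a : Eu d → Matrix (Fin d) (Fin d) ℝ) (b : Eu d → Eu d) (c : Eu d → ℝ) : Ix d → Eu d → ℝ
  | none => fun x => - c x
  | some (Sum.inl i) => fun x => b x i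
  | some (Sum.inr p) => fun x => a x p.1 p.2

variable {d : ℕ} {δ K : ℝ} {a : Eu d → Matrix (Fin d) (Fin d) ℝ} {b : Eu d → Eu d} {c u : Eu d → ℝ}
    {du : Eu d → Eu d} {d2u : Eu d → Matrix (Fin d) (Fin d) ℝ} {f g : Eu d → ℝ}

lemma Dat.coefs_le (D : Dat δ K a b c u du d2u f g) (k : Ix d) (x : Eu d) : |coefs a b c k x| ≤ δ⁻¹ + K := by
  have hδ' : 0 < δ⁻¹ := inv_pos.2 D.hδ
  have h1 := D.bc x
  have h2 := D.c0 x
  have h3 := norm_nonneg (b x)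
  have h4 := D.hK
  rcases k with _ | i | p
  · simp only [coefs, abs_neg, abs_of_nonneg h2]; linarith
  · simp only [coefs]
    have := PiLp.norm_apply_le (b x) i
    rw [Real.norm_eq_abs] at this; linarith
  · simp only [coefs]
    have := ell_entry D.hδ (D.sym x) (D.ell x) p.1 p.2
    linarith

lemma Dat.coefs_meas (D : Dat δ K a b c u du d2u f g) (k : Ix d) : Measurable (coefs a b c k) := by
  rcases k with _ | i | p
  · exact D.mc.neg
  · exact D.mb i
  · exact D.ma _ _

lemma Dat.pieces_meas (D : Dat δ K a b c u du d2u f g) (k : Ix d) : Measurable (pieces u du d2u k) := by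
  rcases k with _ | i | p
  · exact D.mu
  · exact D.mdu i
  · exact D.md2u _ _

lemma Dat.pieces_memLp (hd : 1 ≤ d) (D : Dat δ K a b c u du d2u f g) {R' : ℝ} (hR' : R' < 1) (k : Ix d) :
    MemLp ((Metric.closedBall 0 R').indicator (pieces u du d2u k)) d volume ∧
    Integrable ((Metric.closedBall 0 R').indicator (pieces u du d2u k)) := by
  have hc : IsCompact (Metric.closedBall (0 : Eu d) R') := isCompact_closedBall _ _
  refine memLp_piece hd (D.pieces_meas k) hc (D.sob _ hc (Metric.closedBall_subset_ball hR')) fun x => ?_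
  have h1 : 0 ≤ |u x| ^ (d : ℝ) := by positivity
  have h2 : 0 ≤ ‖du x‖ ^ (d : ℝ) := by positivity
  have h0 : 0 ≤ frobNorm (d2u x) := Real.sqrt_nonneg _
  have h3 : 0 ≤ frobNorm (d2u x) ^ (d : ℝ) := by positivity
  rcases k with _ | i | p
  · simp only [pieces]; linarith
  · simp only [pieces]
    have h4 : |du x i| ≤ ‖du x‖ := PiLp.norm_apply_le (du x) i
    have : |du x i| ^ (d : ℝ) ≤ ‖du x‖ ^ (d : ℝ) := by gcongr
    linarith
  · simp only [pieces]
    have h4 : |d2u x p.1 p.2| ≤ frobNorm (d2u x) := by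
      unfold frobNorm
      apply Real.abs_le_sqrt
      calc (d2u x p.1 p.2) ^ 2 ≤ ∑ j, (d2u x p.1 j) ^ 2 :=
            Finset.single_le_sum (f := fun j => (d2u x p.1 j) ^ 2) (fun j _ => sq_nonneg _) (Finset.mem_univ p.2)
        _ ≤ _ := Finset.single_le_sum (f := fun i => ∑ j, (d2u x i j) ^ 2)
            (fun i _ => Finset.sum_nonneg fun j _ => sq_nonneg _) (Finset.mem_univ p.1)
    have : |d2u x p.1 p.2| ^ (d : ℝ) ≤ frobNorm (d2u x) ^ (d : ℝ) := by gcongr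
    linarith

lemma sum_coefs (m : Ix d → ℝ) (x : Eu d) : ∑ k, coefs a b c k x * m k =
    (∑ i, ∑ j, a x i j * m (some (Sum.inr (i, j)))) + (∑ i, b x i * m (some (Sum.inl i))) - c x * m none := by
  rw [Fintype.sum_option, Fintype.sum_sum_type, Fintype.sum_prod_type]
  simp only [coefs]
  ring

lemma ind_deriv {S : ℝ} {v v' : Eu d → ℝ} {y e : Eu d} (hy : y ∈ Metric.ball (0 : Eu d) S)
    (h : HasDerivAt (fun s : ℝ => v (y + s • e)) (v' y) 0) :
    HasDerivAt (fun s : ℝ => (Metric.closedBall 0 S).indicator v (y + s • e))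
      ((Metric.closedBall 0 S).indicator v' y) 0 := by
  rw [indicator_of_mem (Metric.ball_subset_closedBall hy)]
  refine h.congr_of_eventuallyEq ?_
  have hc : Continuous fun s : ℝ => y + s • e := by fun_prop
  have : ∀ᶠ s in 𝓝 (0 : ℝ), y + s • e ∈ Metric.ball (0 : Eu d) S :=
    hc.continuousAt.eventually_mem (by simpa using Metric.isOpen_ball.mem_nhds hy)
  filter_upwards [this] with s hs
  rw [indicator_of_mem (Metric.ball_subset_closedBall hs)]

end Part12

section Part13

variable {d : ℕ} {δ K : ℝ} {a : Eu d → Matrix (Fin d) (Fin d) ℝ} {b : Eu d → Eu d} {c u : Eu d → ℝ}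
    {du : Eu d → Eu d} {d2u : Eu d → Matrix (Fin d) (Fin d) ℝ} {f g : Eu d → ℝ}

lemma sum_pow_bound {ι : Type*} [Fintype ι] {d : ℕ} (hd : 1 ≤ d) (m e : ι → ℝ) {M : ℝ} (hm : ∀ k, |m k| ≤ M) :
    ‖∑ k, m k * e k‖ₑ ^ d ≤ ENNReal.ofReal M ^ d * ((Fintype.card ι : ℝ≥0∞) ^ ((d : ℝ) - 1) * ∑ k, ‖e k‖ₑ ^ d) := by
  have h1 : ‖∑ k, m k * e k‖ₑ ≤ ENNReal.ofReal M * ∑ k, ‖e k‖ₑ := by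
    refine (enorm_sum_le _ _).trans ?_
    rw [Finset.mul_sum]
    refine Finset.sum_le_sum fun k _ => ?_
    rw [enorm_mul]
    gcongr
    rw [Real.enorm_eq_ofReal_abs]
    exact ENNReal.ofReal_le_ofReal (hm k)
  have h2 := ENNReal.rpow_sum_le_const_mul_sum_rpow (Finset.univ : Finset ι) (fun k => ‖e k‖ₑ) (p := (d : ℝ)) (by exact_mod_cast hd)
  simp only [ENNReal.rpow_natCast, Finset.card_univ] at h2
  calc _ ≤ (ENNReal.ofReal M * ∑ k, ‖e k‖ₑ) ^ d := by gcongr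
    _ = ENNReal.ofReal M ^ d * (∑ k, ‖e k‖ₑ) ^ d := mul_pow _ _ _
    _ ≤ _ := by gcongr

lemma Dat.approx (hd : 1 ≤ d) (D : Dat δ K a b c u du d2u f g) {R : ℝ} (hR : 0 < R) (hR1 : R < 1)
    {η : ℝ} (hη : 0 < η) {θ : ℝ≥0∞} (hθ : 0 < θ) :
    ∃ (w : Eu d → ℝ) (G : Eu d → Eu d) (T : Eu d → Eu d →L[ℝ] Eu d) (h : Eu d → ℝ),
      Sol δ K R a b c w G T (fun x => (g x + h x) - f x) ∧
      (∀ x ∈ Metric.closedBall (0 : Eu d) R, |w x - u x| ≤ η) ∧ Measurable h ∧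
      ∫⁻ x, ‖h x‖ₑ ^ d ≤ θ := by
  obtain ⟨R', hRR', hR'1⟩ := exists_between hR1
  set S := Metric.closedBall (0 : Eu d) R' with hS
  set W : Ix d → Eu d → ℝ := fun k => S.indicator (pieces u du d2u k) with hWdef
  have hWm : ∀ k, Measurable (W k) := fun k =>
    (D.pieces_meas k).indicator Metric.isClosed_closedBall.measurableSet
  have hWL : ∀ k, MemLp (W k) d volume := fun k => (D.pieces_memLp hd hR'1 k).1
  have hWi : ∀ k, Integrable (W k) := fun k => (D.pieces_memLp hd hR'1 k).2
  -- constants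
  set Q : ℝ≥0∞ := ENNReal.ofReal (δ⁻¹ + K) ^ d * ((Fintype.card (Ix d) : ℝ≥0∞) ^ ((d : ℝ) - 1) * (Fintype.card (Ix d) : ℝ≥0∞)) with hQ
  have hQt : Q ≠ ∞ := by
    rw [hQ]
    refine ENNReal.mul_ne_top (ENNReal.pow_ne_top ENNReal.ofReal_ne_top) (ENNReal.mul_ne_top ?_ (ENNReal.natCast_ne_top _))
    refine ENNReal.rpow_ne_top_of_nonneg ?_ (ENNReal.natCast_ne_top _)
    have : (1 : ℝ) ≤ d := by exact_mod_cast hd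
    linarith
  have hθ2 : 0 < θ / (Q + 1) := ENNReal.div_pos hθ.ne' (by simp [hQt])
  choose ε he hconv using fun k => mol_conv hd (hWm k) (hWi k) (hWL k) hθ2
  obtain ⟨k0, hk0⟩ := Finite.exists_min ε
  -- uniform continuity
  have huc := (isCompact_closedBall (0 : Eu d) 1).uniformContinuousOn_of_continuous D.cont
  obtain ⟨ε1, he1, huc⟩ := Metric.uniformContinuousOn_iff.1 huc η hη
  obtain ⟨e, hepos, hemin⟩ := exists_between (show 0 < min (ε k0) (min ε1 (R' - R)) from lt_min (he k0) (lt_min he1 (by linarith)))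
  have hel1 : e < ε k0 := hemin.trans_le (min_le_left _ _)
  have hel2 : e < ε1 := hemin.trans_le ((min_le_right _ _).trans (min_le_left _ _))
  have hel3 : e < R' - R := hemin.trans_le ((min_le_right _ _).trans (min_le_right _ _))
  obtain ⟨φ, hφ, hφs, hφp, hφ1, hφe⟩ := exists_mollifier (d := d) hepos
  have hball : ∀ x ∈ Metric.ball (0 : Eu d) R, ∀ y ∈ Metric.closedBall x e, y ∈ Metric.ball (0 : Eu d) R' := by
    intro x hx y hy
    rw [Metric.mem_ball] at hx ⊢
    rw [Metric.mem_closedBall] at hy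
    linarith [dist_triangle y x 0]
  have hb1 : ∀ y ∈ Metric.ball (0 : Eu d) R', y ∈ Metric.ball (0 : Eu d) 1 := fun y hy =>
    Metric.ball_subset_ball hR'1.le hy
  refine ⟨mol φ (W none), fun x => WithLp.toLp 2 fun i => mol φ (W (some (Sum.inl i))) x,
    fun x => rows fun i j => mol φ (W (some (Sum.inr (i, j)))) x,
    fun x => ∑ k, coefs a b c k x * (mol φ (W k) x - W k x), ?_, ?_, ?_, ?_⟩
  · refine ⟨D.hδ, D.hK, hR, hR1.le, D.ell, D.bc, D.c0, (continuous_mol hφ.continuous hφs (hWi _)).continuousOn, ?_, ?_, ?_⟩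
    · intro x hx
      refine mol_deriv hφ hφs hφe (hWi _) (fun i => hWi _) x fun y hy i => ?_
      have hyR := hball x hx y hy
      exact ind_deriv (v' := fun x => du x i) hyR (D.hdu y (hb1 y hyR) i)
    · intro x hx
      refine mol_deriv2 hφ hφs hφe (fun i => hWi _) (fun i j => hWi _) x fun y hy i j => ?_
      have hyR := hball x hx y hy
      exact ind_deriv (v := fun x => du x i) (v' := fun x => d2u x i j) hyR (D.hd2u y (hb1 y hyR) i j)
    · intro x hx
      have hxS : x ∈ S := by
        rw [hS]; rw [Metric.mem_ball] at hx; rw [Metric.mem_closedBall]; linarith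
      have hx1 : x ∈ Metric.ball (0 : Eu d) 1 := Metric.ball_subset_ball hR1.le hx
      have hp := D.pde x hx1
      have hW : ∀ k, W k x = pieces u du d2u k x := fun k => indicator_of_mem hxS _
      have s1 := sum_coefs (a := a) (b := b) (c := c) (fun k => mol φ (W k) x) x
      have s2 : ∑ k, coefs a b c k x * pieces u du d2u k x =
          (∑ i, ∑ j, a x i j * d2u x i j) + (∑ i, b x i * du x i) - c x * u x :=
        sum_coefs (a := a) (b := b) (c := c) (fun k => pieces u du d2u k x) x
      have e1 : ∑ k, coefs a b c k x * (mol φ (W k) x - W k x) = ∑ k, coefs a b c k x * mol φ (W k) x - ∑ k, coefs a b c k x * pieces u du d2u k x := by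
        simp_rw [hW, mul_sub, Finset.sum_sub_distrib]
      have e2 : trA (a x) (rows fun i j => mol φ (W (some (Sum.inr (i, j)))) x) = ∑ i, ∑ j, a x i j * mol φ (W (some (Sum.inr (i, j)))) x := by
        unfold trA; simp_rw [rows_eb]
      have e3 : inner ℝ (b x) (WithLp.toLp 2 fun i => mol φ (W (some (Sum.inl i))) x : Eu d) = ∑ i, b x i * mol φ (W (some (Sum.inl i))) x := by
        simp [PiLp.inner_apply, mul_comm]
      simp only [e1, e2, e3, s1]
      rw [s2, hp]
      linarith
  · intro x hx
    have hxn : ‖x‖ ≤ R := by simpa using hx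
    have hmem : ∀ t : Eu d, ‖t‖ ≤ e → x - t ∈ S := by
      intro t ht
      rw [hS, Metric.mem_closedBall, dist_zero_right]
      linarith [norm_sub_le x t]
    have hmem1 : ∀ t : Eu d, ‖t‖ ≤ e → x - t ∈ Metric.closedBall (0 : Eu d) 1 := fun t ht =>
      Metric.closedBall_subset_closedBall hR'1.le (hmem t ht)
    have hx0 := hmem 0 (by simpa using hepos.le)
    have hx01 := hmem1 0 (by simpa using hepos.le)
    rw [sub_zero] at hx0 hx01
    have hWx : W none x = u x := indicator_of_mem hx0 _
    rw [← hWx]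
    refine mol_unif hφ.continuous hφs hφp hφ1 (hWi _) hφe x fun t ht => ?_
    have hWt : W none (x - t) = u (x - t) := indicator_of_mem (hmem t ht) _
    rw [hWx, hWt]
    have := huc _ (hmem1 t ht) _ hx01 (by rw [dist_eq_norm]; simp; linarith)
    rw [Real.dist_eq] at this
    exact this.le
  · refine Finset.measurable_sum _ fun k _ => (D.coefs_meas k).mul ?_
    exact (continuous_mol hφ.continuous hφs (hWi _)).measurable.sub (hWm k)
  · have hmE : ∀ k, Measurable fun x => ‖mol φ (W k) x - W k x‖ₑ ^ d := fun k =>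
      ((continuous_mol hφ.continuous hφs (hWi _)).measurable.sub (hWm k)).enorm.pow_const d
    calc _ ≤ ∫⁻ x, ENNReal.ofReal (δ⁻¹ + K) ^ d * ((Fintype.card (Ix d) : ℝ≥0∞) ^ ((d : ℝ) - 1) * ∑ k, ‖mol φ (W k) x - W k x‖ₑ ^ d) :=
          lintegral_mono fun x => sum_pow_bound hd _ _ fun k => D.coefs_le k x
      _ = ENNReal.ofReal (δ⁻¹ + K) ^ d * ((Fintype.card (Ix d) : ℝ≥0∞) ^ ((d : ℝ) - 1) * ∑ k, ∫⁻ x, ‖mol φ (W k) x - W k x‖ₑ ^ d) := by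
          rw [lintegral_const_mul _ ((Finset.measurable_sum _ fun k _ => hmE k).const_mul _), lintegral_const_mul _ (Finset.measurable_sum _ fun k _ => hmE k),
            lintegral_finsetSum _ fun k _ => hmE k]
      _ ≤ ENNReal.ofReal (δ⁻¹ + K) ^ d * ((Fintype.card (Ix d) : ℝ≥0∞) ^ ((d : ℝ) - 1) * ∑ k : Ix d, θ / (Q + 1)) := by
          gcongr with k _
          exact hconv k φ hφ.continuous hφs hφp hφ1 (hφe.trans (Metric.closedBall_subset_closedBall (hel1.le.trans (hk0 k))))
      _ = Q * (θ / (Q + 1)) := by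
          rw [hQ, Finset.sum_const, Finset.card_univ, nsmul_eq_mul]; ring
      _ ≤ (Q + 1) * (θ / (Q + 1)) := by gcongr; simp
      _ ≤ θ := ENNReal.mul_div_le

end Part13

section Part14

variable {d : ℕ} {δ K : ℝ} {a : Eu d → Matrix (Fin d) (Fin d) ℝ} {b : Eu d → Eu d} {c u : Eu d → ℝ}
    {du : Eu d → Eu d} {d2u : Eu d → Matrix (Fin d) (Fin d) ℝ} {f g : Eu d → ℝ}

lemma near_boundary (D : Dat δ K a b c u du d2u f g) {m : ℝ}
    (hm : ∀ x ∈ Metric.sphere (0 : Eu d) 1, -m ≤ u x) {η : ℝ} (hη : 0 < η) :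
    ∃ R0 : ℝ, 1 / 2 ≤ R0 ∧ R0 < 1 ∧ ∀ R, R0 ≤ R → R < 1 → ∀ x ∈ Metric.sphere (0 : Eu d) R, -m - η ≤ u x := by
  have huc := (isCompact_closedBall (0 : Eu d) 1).uniformContinuousOn_of_continuous D.cont
  obtain ⟨ε1, he1, huc⟩ := Metric.uniformContinuousOn_iff.1 huc η hη
  refine ⟨max (1 / 2) (1 - ε1 / 2), le_max_left _ _, max_lt (by norm_num) (by linarith), fun R hR0 hR1 x hx => ?_⟩
  have h1 : 1 / 2 ≤ R := (le_max_left _ _).trans hR0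
  have h2 : 1 - ε1 / 2 ≤ R := (le_max_right _ _).trans hR0
  have hxn : ‖x‖ = R := by simpa using hx
  have hRp : 0 < R := by linarith
  have hyn : ‖R⁻¹ • x‖ = 1 := by
    rw [norm_smul, hxn, Real.norm_of_nonneg (by positivity)]; field_simp
  have hdist : dist x (R⁻¹ • x) < ε1 := by
    have e : x - R⁻¹ • x = (1 - R⁻¹) • x := by rw [sub_smul, one_smul]
    have h3 : 1 - R⁻¹ ≤ 0 := by
      have := (one_le_inv₀ hRp).2 hR1.le
      linarith
    rw [dist_eq_norm, e, norm_smul, hxn, Real.norm_of_nonpos h3]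
    have : -(1 - R⁻¹) * R = 1 - R := by field_simp; ring
    rw [this]; linarith
  have := huc x (by simp [hxn]; linarith) (R⁻¹ • x) (by simp [hyn]) hdist
  rw [Real.dist_eq, abs_lt] at this
  have h5 := hm (R⁻¹ • x) (by simp [hyn])
  linarith [this.1]

lemma rpow_one_div_le_iff_aux {x y : ℝ≥0∞} {z : ℝ} (hz : 0 < z) : x ^ (1 / z) ≤ y ↔ x ≤ y ^ z := by
  rw [← ENNReal.rpow_le_rpow_iff hz, ← ENNReal.rpow_mul, one_div_mul_cancel hz.ne', ENNReal.rpow_one]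

lemma Ig_add_le (hd : 1 ≤ d) {A : Set (Eu d)} {g h : Eu d → ℝ} (hg : Measurable g) (hh : Measurable h) {J η : ℝ}
    (hJ : 0 ≤ J) (hη : 0 ≤ η) (h1 : ∫⁻ x in A, ENNReal.ofReal (max (g x) 0) ^ (d : ℝ) ≤ ENNReal.ofReal J ^ (d : ℝ))
    (h2 : ∫⁻ x, ‖h x‖ₑ ^ d ≤ ENNReal.ofReal (η ^ d)) :
    Ig A (fun x => g x + h x) ≤ ENNReal.ofReal ((J + η) ^ d) := by
  have hd1 : (1 : ℝ) ≤ d := by exact_mod_cast hd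
  have hd0 : (0 : ℝ) < d := by linarith
  have h3 := ENNReal.lintegral_Lp_add_le (μ := volume.restrict A) (f := fun x => ENNReal.ofReal (max (g x) 0))
    (g := fun x => ‖h x‖ₑ) (p := (d : ℝ)) (by fun_prop) (by fun_prop) hd1
  have h4 : (∫⁻ x in A, ENNReal.ofReal (max (g x) 0) ^ (d : ℝ)) ^ (1 / (d : ℝ)) ≤ ENNReal.ofReal J := by
    rw [rpow_one_div_le_iff_aux hd0]; exact h1
  have h5 : (∫⁻ x in A, ‖h x‖ₑ ^ (d : ℝ)) ^ (1 / (d : ℝ)) ≤ ENNReal.ofReal η := by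
    rw [rpow_one_div_le_iff_aux hd0]
    simp only [ENNReal.rpow_natCast]
    rw [← ENNReal.ofReal_pow hη]
    exact (setLIntegral_le_lintegral _ _).trans h2
  have h6 := h3.trans (add_le_add h4 h5)
  rw [rpow_one_div_le_iff_aux hd0, ← ENNReal.ofReal_add hJ hη, ENNReal.rpow_natCast, ← ENNReal.ofReal_pow (add_nonneg hJ hη)] at h6
  refine le_trans (lintegral_mono fun x => ?_) h6
  simp only [Pi.add_apply, ENNReal.rpow_natCast]
  rw [ENNReal.ofReal_pow (le_max_right _ _)]
  gcongr
  rw [Real.enorm_eq_ofReal_abs, ← ENNReal.ofReal_add (le_max_right _ _) (abs_nonneg _)]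
  refine ENNReal.ofReal_le_ofReal (max_le ?_ ?_)
  · linarith [le_max_left (g x) 0, le_abs_self (h x)]
  · linarith [le_max_right (g x) 0, abs_nonneg (h x)]

lemma main_est (hd : 1 ≤ d) (δ K : ℝ) (hδ : 0 < δ) (hK : 0 ≤ K) : ∃ γ N : ℝ, 0 < γ ∧ γ ≤ 1 ∧ 0 < N ∧
    ∀ {a : Eu d → Matrix (Fin d) (Fin d) ℝ} {b : Eu d → Eu d} {c u : Eu d → ℝ}
    {du : Eu d → Eu d} {d2u : Eu d → Matrix (Fin d) (Fin d) ℝ} {f g : Eu d → ℝ} (_ : Dat δ K a b c u du d2u f g)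
    {A m J : ℝ} (_ : 0 ≤ A) (_ : u 0 ≤ A) (_ : 0 ≤ m) (_ : ∀ x ∈ Metric.sphere (0 : Eu d) 1, -m ≤ u x) (_ : 0 ≤ J)
    (_ : ∫⁻ x in Metric.ball (0 : Eu d) 1, ENNReal.ofReal (max (g x) 0) ^ (d : ℝ) ≤ ENNReal.ofReal J ^ (d : ℝ)),
    ∫⁻ x in Metric.ball (0 : Eu d) 1, ENNReal.ofReal (f x) ^ γ ≤ ENNReal.ofReal (N * (A + m + J) ^ γ) := by
  obtain ⟨γ, N, hγ, hγ1, hN, hest⟩ := smooth_est (d := d) hd δ K hδ hK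
  refine ⟨γ, N, hγ, hγ1, hN, ?_⟩
  intro a b c u du d2u f g D A m J hA hA0 hm hm0 hJ hJ0
  have step : ∀ η : ℝ, 0 < η → ∫⁻ x in Metric.ball (0 : Eu d) 1, ENNReal.ofReal (f x) ^ γ ≤
      ENNReal.ofReal (N * (A + m + J + 2 * η) ^ γ) := by
    intro η hη
    obtain ⟨R0, hR0, hR01, hbd⟩ := near_boundary D hm0 hη
    have hR : ∀ R, R0 ≤ R → R < 1 → ∫⁻ x in Metric.ball (0 : Eu d) R, ENNReal.ofReal (f x) ^ γ ≤
        ENNReal.ofReal (N * (A + m + J + 2 * η) ^ γ) := by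
      intro R hRR hR1
      obtain ⟨w, G, T, h, hsol, hclose, hhm, hh⟩ := D.approx hd (R := R) (by linarith) hR1 hη
        (θ := ENNReal.ofReal (η ^ d)) (ENNReal.ofReal_pos.2 (by positivity))
      refine hest (s := A + m + J + 2 * η) hsol (by linarith) (fun x hx => D.hf x (Metric.ball_subset_ball hR1.le hx))
        (by linarith) ?_ ?_ ?_
      · have := hclose 0 (by simp; linarith)
        linarith [le_abs_self (w 0 - u 0)]
      · intro x hx
        have h1 := hclose x (Metric.sphere_subset_closedBall hx)
        have h2 := hbd R hRR hR1 x hx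
        linarith [neg_abs_le (w x - u x)]
      · refine (Ig_add_le hd D.mg hhm hJ hη.le ?_ hh).trans (ENNReal.ofReal_le_ofReal ?_)
        · exact (lintegral_mono_set (Metric.ball_subset_ball hR1.le)).trans hJ0
        · exact pow_le_pow_left₀ (by linarith) (by linarith) d
    have hU : Metric.ball (0 : Eu d) 1 = ⋃ n : ℕ, Metric.ball (0 : Eu d) (max R0 (1 - 1 / ((n : ℝ) + 1))) := by
      ext x
      simp only [mem_iUnion, Metric.mem_ball]
      constructor
      · intro hx
        obtain ⟨n, hn⟩ := exists_nat_one_div_lt (show 0 < 1 - dist x 0 by linarith)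
        exact ⟨n, lt_max_of_lt_right (by linarith)⟩
      · rintro ⟨n, hn⟩
        refine hn.trans (max_lt hR01 ?_)
        have : (0 : ℝ) < 1 / ((n : ℝ) + 1) := by positivity
        linarith
    rw [hU, setLIntegral_iUnion_of_directed]
    · refine iSup_le fun n => hR _ (le_max_left _ _) (max_lt hR01 ?_)
      have : (0 : ℝ) < 1 / ((n : ℝ) + 1) := by positivity
      linarith
    · refine Monotone.directed_le fun n k hnk => Metric.ball_subset_ball (max_le_max le_rfl ?_)
      have : 1 / ((k : ℝ) + 1) ≤ 1 / ((n : ℝ) + 1) := by gcongr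
      linarith
  have hc : Continuous fun η : ℝ => ENNReal.ofReal (N * (A + m + J + 2 * η) ^ γ) := by
    refine ENNReal.continuous_ofReal.comp (continuous_const.mul ?_)
    exact (Real.continuous_rpow_const hγ.le).comp (by fun_prop)
  have ht := (hc.tendsto 0).mono_left (nhdsWithin_le_nhds (s := Ioi 0))
  simp only [mul_zero, add_zero] at ht
  refine ge_of_tendsto ht ?_
  filter_upwards [self_mem_nhdsWithin] with η hη
  exact step η hη

lemma sup_neg_facts (D : Dat δ K a b c u du d2u f g) :
    0 ≤ (⨆ x ∈ Metric.sphere (0 : Eu d) 1, max (-u x) 0) ∧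
    ∀ x ∈ Metric.sphere (0 : Eu d) 1, -(⨆ x ∈ Metric.sphere (0 : Eu d) 1, max (-u x) 0) ≤ u x := by
  refine ⟨Real.iSup_nonneg fun x => Real.iSup_nonneg fun _ => le_max_right _ _, fun x hx => ?_⟩
  obtain ⟨C, hC⟩ := (isCompact_closedBall (0 : Eu d) 1).exists_bound_of_continuousOn D.cont
  have hbdd : BddAbove (range fun x : Eu d => ⨆ (_ : x ∈ Metric.sphere (0 : Eu d) 1), max (-u x) 0) := by
    refine ⟨max C 0, ?_⟩
    rintro _ ⟨y, rfl⟩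
    refine Real.iSup_le (fun hy => max_le_max ?_ le_rfl) (le_max_right _ _)
    exact (neg_le_abs _).trans (hC y (Metric.sphere_subset_closedBall hy))
  have h1 := le_ciSup hbdd x
  simp only [ciSup_pos hx] at h1
  linarith [le_max_left (-u x) 0]

lemma ofReal_abs_ball (D : Dat δ K a b c u du d2u f g) (γ : ℝ) :
    (∫⁻ x in Metric.ball (0 : Eu d) 1, ENNReal.ofReal |f x| ^ γ ∂volume) =
    ∫⁻ x in Metric.ball (0 : Eu d) 1, ENNReal.ofReal (f x) ^ γ ∂volume :=
  setLIntegral_congr_fun Metric.isOpen_ball.measurableSet fun x hx => by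
    simp only [abs_of_nonneg (D.hf x hx)]

theorem final_est
    (d : ℕ) (hd : 1 ≤ d) (δ K : ℝ) (hδ0 : 0 < δ) (hK : 0 ≤ K) :
    ∃ γ N : ℝ, γ ∈ Set.Ioc (0 : ℝ) 1 ∧ 0 < N ∧
      ∀ {a : Eu d → Matrix (Fin d) (Fin d) ℝ} {b : Eu d → Eu d} {c u : Eu d → ℝ}
        {du : Eu d → Eu d} {d2u : Eu d → Matrix (Fin d) (Fin d) ℝ} {f g : Eu d → ℝ},
        Dat δ K a b c u du d2u f g →
        (∫⁻ x in Metric.ball (0 : EuclideanSpace ℝ (Fin d)) 1,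
            ENNReal.ofReal |f x| ^ γ ∂volume)
          ≤ ENNReal.ofReal N *
              (∫⁻ x in Metric.ball (0 : EuclideanSpace ℝ (Fin d)) 1,
                ENNReal.ofReal (max (g x) 0) ^ (d : ℝ) ∂volume) ^ (γ / (d : ℝ))
            + ENNReal.ofReal N *
              ENNReal.ofReal (|max (u (0 : EuclideanSpace ℝ (Fin d))) 0| ^ γ)
            + ENNReal.ofReal N *
              ENNReal.ofReal
                ((⨆ x ∈ Metric.sphere (0 : EuclideanSpace ℝ (Fin d)) 1, max (-u x) 0) ^ γ) := by
  obtain ⟨γ, N, hγ, hγ1, hN, hest⟩ := main_est (d := d) hd δ K hδ0 hK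
  refine ⟨γ, N, ⟨hγ, hγ1⟩, hN, fun {a b c u du d2u f g} D => ?_⟩
  rw [ofReal_abs_ball D]
  obtain ⟨hm0, hm⟩ := sup_neg_facts D
  set m := ⨆ x ∈ Metric.sphere (0 : EuclideanSpace ℝ (Fin d)) 1, max (-u x) 0
  set I := ∫⁻ x in Metric.ball (0 : EuclideanSpace ℝ (Fin d)) 1, ENNReal.ofReal (max (g x) 0) ^ (d : ℝ) with hI
  have hd0 : (0 : ℝ) < d := by exact_mod_cast hd
  have hNe : ENNReal.ofReal N ≠ 0 := by simpa using hN
  by_cases hIt : I = ∞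
  · rw [hIt, ENNReal.top_rpow_of_pos (by positivity), ENNReal.mul_top hNe]; simp
  have hIr : I ^ (1 / (d : ℝ)) ≠ ∞ := ENNReal.rpow_ne_top_of_nonneg (by positivity) hIt
  have hJ : ENNReal.ofReal (I ^ (1 / (d : ℝ))).toReal = I ^ (1 / (d : ℝ)) := ENNReal.ofReal_toReal hIr
  have hA : 0 ≤ max (u 0) 0 := le_max_right _ _
  have h1 := hest D hA (le_max_left _ _) hm0 hm (J := (I ^ (1 / (d : ℝ))).toReal) ENNReal.toReal_nonneg (by
    rw [hJ, ← ENNReal.rpow_mul, one_div_mul_cancel hd0.ne', ENNReal.rpow_one])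
  refine h1.trans ?_
  have hJ0 : 0 ≤ (I ^ (1 / (d : ℝ))).toReal := ENNReal.toReal_nonneg
  have hJγ : I ^ (γ / (d : ℝ)) = ENNReal.ofReal ((I ^ (1 / (d : ℝ))).toReal ^ γ) := by
    rw [← ENNReal.ofReal_rpow_of_nonneg hJ0 hγ.le, hJ, ← ENNReal.rpow_mul]
    congr 1; ring
  rw [hJγ, abs_of_nonneg hA]
  set J := (I ^ (1 / (d : ℝ))).toReal
  have h2 : (max (u 0) 0 + m + J) ^ γ ≤ (max (u 0) 0) ^ γ + m ^ γ + J ^ γ := by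
    have e1 := Real.rpow_add_le_add_rpow (add_nonneg hA hm0) hJ0 hγ.le hγ1
    have e2 := Real.rpow_add_le_add_rpow hA hm0 hγ.le hγ1
    linarith
  have p1 : 0 ≤ (max (u 0) 0) ^ γ := by positivity
  have p2 : 0 ≤ m ^ γ := by positivity
  have p3 : 0 ≤ J ^ γ := by positivity
  rw [← mul_add, ← mul_add, ← ENNReal.ofReal_add p3 p1, ← ENNReal.ofReal_add (add_nonneg p3 p1) p2, ← ENNReal.ofReal_mul hN.le]
  refine ENNReal.ofReal_le_ofReal (mul_le_mul_of_nonneg_left ?_ hN.le)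
  linarith

end Part14

/-- **Lemma 1.7.** There are constants `γ ∈ (0,1]` and `N`, depending only on `δ`, `K`, `d`,
such that, if `L ∈ 𝔏_{δ,K}` has coefficients independent of `t`
(`Lu = aⁱʲD_{ij}u + bⁱDᵢu - cu`), `u ∈ W²_{d,loc}(B₁) ∩ C(B̄₁)` and `Lu = g - f` in `B₁`
with `f ≥ 0`, then
`∫_{B₁} |f|^γ ≤ N (∫_{B₁} |g₊|^d)^{γ/d} + N |u₊(0)|^γ + N sup_{∂B₁} |u₋|^γ`. -/
theorem elliptic_estimate_of_decomposition
    (d : ℕ) (hd : 1 ≤ d) (δ K : ℝ) (hδ0 : 0 < δ) (hδ1 : δ < 1) (hK : 0 ≤ K) :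
    ∃ γ N : ℝ, γ ∈ Set.Ioc (0 : ℝ) 1 ∧ 0 < N ∧
      ∀ (a : EuclideanSpace ℝ (Fin d) → Matrix (Fin d) (Fin d) ℝ)
        (b : EuclideanSpace ℝ (Fin d) → EuclideanSpace ℝ (Fin d))
        (c : EuclideanSpace ℝ (Fin d) → ℝ)
        (u : EuclideanSpace ℝ (Fin d) → ℝ)
        (du : EuclideanSpace ℝ (Fin d) → EuclideanSpace ℝ (Fin d))
        (d2u : EuclideanSpace ℝ (Fin d) → Matrix (Fin d) (Fin d) ℝ)
        (f g : EuclideanSpace ℝ (Fin d) → ℝ),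
        -- measurability of the coefficients of `L ∈ 𝔏_{δ,K}`
        (∀ i j, Measurable fun x => a x i j) →
        (∀ i, Measurable fun x => b x i) →
        Measurable c →
        -- `a` is `S_δ`-valued
        (∀ x, (a x).IsSymm) →
        (∀ x (ξ : EuclideanSpace ℝ (Fin d)),
          δ * ‖ξ‖ ^ 2 ≤ ∑ i, ∑ j, a x i j * ξ i * ξ j ∧
          ∑ i, ∑ j, a x i j * ξ i * ξ j ≤ δ⁻¹ * ‖ξ‖ ^ 2) →
        -- `|b| + c ≤ K`, `c ≥ 0`
        (∀ x, ‖b x‖ + c x ≤ K) →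
        (∀ x, 0 ≤ c x) →
        -- measurability
        Measurable u →
        (∀ i, Measurable fun x => du x i) →
        (∀ i j, Measurable fun x => d2u x i j) →
        Measurable f → Measurable g →
        -- `u ∈ C(B̄₁)`
        ContinuousOn u (Metric.closedBall (0 : EuclideanSpace ℝ (Fin d)) 1) →
        -- `du = Du`, `d2u = D²u` pointwise in `B₁`
        (∀ x ∈ Metric.ball (0 : EuclideanSpace ℝ (Fin d)) 1, ∀ i,
          HasDerivAt (fun s : ℝ => u (x + s • EuclideanSpace.single i (1 : ℝ))) (du x i) 0) →
        (∀ x ∈ Metric.ball (0 : EuclideanSpace ℝ (Fin d)) 1, ∀ i j,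
          HasDerivAt (fun s : ℝ => du (x + s • EuclideanSpace.single j (1 : ℝ)) i) (d2u x i j) 0) →
        -- `u ∈ W²_{d,loc}(B₁)`
        (∀ G : Set (EuclideanSpace ℝ (Fin d)), IsCompact G →
          G ⊆ Metric.ball (0 : EuclideanSpace ℝ (Fin d)) 1 →
          IntegrableOn (fun x => |u x| ^ (d : ℝ) + ‖du x‖ ^ (d : ℝ) + frobNorm (d2u x) ^ (d : ℝ))
            G volume) →
        -- `f ≥ 0` and `Lu = g - f` in `B₁`
        (∀ x ∈ Metric.ball (0 : EuclideanSpace ℝ (Fin d)) 1, 0 ≤ f x) →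
        (∀ x ∈ Metric.ball (0 : EuclideanSpace ℝ (Fin d)) 1,
          (∑ i, ∑ j, a x i j * d2u x i j) + (∑ i, b x i * du x i) - c x * u x = g x - f x) →
        (∫⁻ x in Metric.ball (0 : EuclideanSpace ℝ (Fin d)) 1,
            ENNReal.ofReal |f x| ^ γ ∂volume)
          ≤ ENNReal.ofReal N *
              (∫⁻ x in Metric.ball (0 : EuclideanSpace ℝ (Fin d)) 1,
                ENNReal.ofReal (max (g x) 0) ^ (d : ℝ) ∂volume) ^ (γ / (d : ℝ))
            + ENNReal.ofReal N *
              ENNReal.ofReal (|max (u (0 : EuclideanSpace ℝ (Fin d))) 0| ^ γ)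
            + ENNReal.ofReal N *
              ENNReal.ofReal
                ((⨆ x ∈ Metric.sphere (0 : EuclideanSpace ℝ (Fin d)) 1, max (-u x) 0) ^ γ) := by
  obtain ⟨γ, N, hγ, hN, h⟩ := final_est d hd δ K hδ0 hK
  refine ⟨γ, N, hγ, hN, ?_⟩
  intro a b c u du d2u f g ma mb mc sym ell bc c0 mu mdu md2u mf mg cont hdu hd2u sob hf pde
  exact h ⟨hδ0, hK, ma, mb, mc, sym, ell, bc, c0, mu, mdu, md2u, mf, mg, cont, hdu, hd2u, sob, hf, pde⟩
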